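/- Consider the problem: minimize f(x) + λ1(g(x)) over x ∈ 𝕏 subject to h(x) = 0, where f, g, h are twice continuously differentiable and λ1 is the largest-eigenvalue function on Sⁿ. Let x̄ be a stationary point at which Robinson's constraint qualification h'(x̄)𝕏 = 𝕐 holds. If the uniform quadratic growth condition holds at x̄ (with respect to every C²-smooth parameterization of the problem), then the strong second-order sufficient condition holds at x̄: for every d ≠ 0 in ⋂_{(ȳ,Ȳ)∈M(x̄)} app(ȳ,Ȳ), sup_{(ȳ,Ȳ)∈M(x̄)} { ⟨d, L''_{xx}(x̄,ȳ,Ȳ)d⟩ − Υ¹_{g(x̄)}(Ȳ, g'(x̄)d) } > 0. -/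

import Mathlib

open Matrix Filter Topology Set
open scoped Classical

noncomputable section

/-- The vector of eigenvalues of a symmetric matrix, in non-increasing order. -/
noncomputable def lamVec {n : ℕ} (X : Matrix (Fin n) (Fin n) ℝ) : Fin n → ℝ :=
  if h : X.IsHermitian then fun i => (h.eigenvalues ∘ Tuple.sort h.eigenvalues) i.rev else 0

/-- The set `𝕆ⁿ(X)` of orthogonal matrices giving an ordered eigenvalue decomposition of `X`. -/
def OSet {n : ℕ} (X : Matrix (Fin n) (Fin n) ℝ) : Set (Matrix (Fin n) (Fin n) ℝ) :=
  {U | Uᵀ * U = 1 ∧ X = U * Matrix.diagonal (lamVec X) * Uᵀ}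

/-- One-sided directional derivative of a scalar function. -/
noncomputable def dirDeriv {E : Type*} [AddCommMonoid E] [Module ℝ E] (f : E → ℝ) (x h : E) : ℝ :=
  limUnder (𝓝[>] (0:ℝ)) fun t => (f (x + t • h) - f x) / t

/-- Vector of one-sided directional derivatives of the ordered eigenvalues: `λ'(X;H)`. -/
noncomputable def lamDD {n : ℕ} (X H : Matrix (Fin n) (Fin n) ℝ) : Fin n → ℝ :=
  fun i => dirDeriv (fun Y => lamVec Y i) X H

/-- The max-of-affine convex piecewise affine function `φ(x) = max_i (⟨aⁱ,x⟩ - cᵢ)`. -/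
noncomputable def pwa {n p : ℕ} [NeZero p] (a : Fin p → Fin n → ℝ) (c : Fin p → ℝ)
    (x : Fin n → ℝ) : ℝ :=
  ⨆ i, (a i ⬝ᵥ x - c i)

/-- The active index set `ι(x̄)` of a max-of-affine function at `x̄`. -/
def iotaA {n p : ℕ} [NeZero p] (a : Fin p → Fin n → ℝ) (c : Fin p → ℝ)
    (x : Fin n → ℝ) : Set (Fin p) :=
  {i | a i ⬝ᵥ x - c i = pwa a c x}

/-- Frobenius inner product of two matrices. -/
def mip {n : ℕ} (A B : Matrix (Fin n) (Fin n) ℝ) : ℝ := (Aᵀ * B).trace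

/-- Convex subdifferential (over the space of symmetric matrices) of a real function. -/
def msubdiff {n : ℕ} (f : Matrix (Fin n) (Fin n) ℝ → ℝ) (X : Matrix (Fin n) (Fin n) ℝ) :
    Set (Matrix (Fin n) (Fin n) ℝ) :=
  {G | G.IsSymm ∧ ∀ Y : Matrix (Fin n) (Fin n) ℝ, Y.IsSymm → f X + mip G (Y - X) ≤ f Y}

/-- Moore–Penrose pseudo-inverse, via the four Penrose conditions. -/
noncomputable def mpInv {n : ℕ} (A : Matrix (Fin n) (Fin n) ℝ) : Matrix (Fin n) (Fin n) ℝ :=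
  Classical.epsilon fun B => A * B * A = A ∧ B * A * B = B ∧ (A * B)ᵀ = A * B ∧ (B * A)ᵀ = B * A

/-- The sigma-term function
`Υ_X(Y,H) = 2 ∑_l ⟨Λ(Y)_{αˡαˡ}, Uᵀ_{αˡ} H (X - v̄ₗ I)† H U_{αˡ}⟩` (written as a single sum
over eigenvalue indices). -/
noncomputable def Upsilon {n : ℕ} (X Y U H : Matrix (Fin n) (Fin n) ℝ) : ℝ :=
  2 * ∑ i, lamVec Y i *
    ((Uᵀ * H * mpInv (X - lamVec X i • (1 : Matrix (Fin n) (Fin n) ℝ)) * H * U) i i)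

open scoped RealInnerProductSpace

attribute [local instance] Matrix.normedAddCommGroup Matrix.normedSpace

/-- The sigma term `Υ_X(Y,H)` computed with a chosen common ordered eigenbasis of `X` and `Y`
(its value does not depend on this choice). -/
noncomputable def UpsilonC {n : ℕ} (X Y H : Matrix (Fin n) (Fin n) ℝ) : ℝ :=
  Upsilon X Y (Classical.epsilon fun U => U ∈ OSet X ∩ OSet Y) H


lemma aux_herm {n : ℕ} {X : Matrix (Fin n) (Fin n) ℝ} (h : X.IsSymm) : X.IsHermitian := by
  rw [Matrix.IsHermitian, Matrix.conjTranspose_eq_transpose_of_trivial]; exact h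

lemma lamVec_antitone {n : ℕ} (X : Matrix (Fin n) (Fin n) ℝ) : Antitone (lamVec X) := by
  unfold lamVec
  split_ifs with h
  · intro i j hij
    exact Tuple.monotone_sort h.eigenvalues (Fin.rev_le_rev.mpr hij)
  · intro i j _; simp

lemma exists_OSet {n : ℕ} {X : Matrix (Fin n) (Fin n) ℝ} (hX : X.IsSymm) : ∃ U, U ∈ OSet X := by
  have h := aux_herm hX
  set V : Matrix (Fin n) (Fin n) ℝ := (h.eigenvectorUnitary : Matrix (Fin n) (Fin n) ℝ) with hV
  have hVV : Vᵀ * V = 1 := by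
    have := (Matrix.mem_unitaryGroup_iff' (A := V)).mp h.eigenvectorUnitary.2
    rwa [Matrix.star_eq_conjTranspose, Matrix.conjTranspose_eq_transpose_of_trivial] at this
  have hsp : X = V * Matrix.diagonal h.eigenvalues * Vᵀ := by
    have := h.spectral_theorem
    rw [Unitary.conjStarAlgAut_apply] at this
    rw [Matrix.star_eq_conjTranspose, Matrix.conjTranspose_eq_transpose_of_trivial] at this
    exact this
  let e : Equiv.Perm (Fin n) := (Fin.revPerm).trans (Tuple.sort h.eigenvalues)
  have hl : lamVec X = h.eigenvalues ∘ e := by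
    unfold lamVec; rw [dif_pos h]; rfl
  refine ⟨V.submatrix id e, ?_, ?_⟩
  · rw [Matrix.transpose_submatrix]
    have h2 := Matrix.submatrix_mul_equiv Vᵀ V e (Equiv.refl _) e
    rw [hVV, Matrix.submatrix_one_equiv] at h2
    exact h2
  · rw [hl]
    have h1 : Matrix.diagonal (h.eigenvalues ∘ e) = (Matrix.diagonal h.eigenvalues).submatrix e e :=
      (Matrix.submatrix_diagonal_equiv _ e).symm
    rw [h1, Matrix.transpose_submatrix, Matrix.submatrix_mul_equiv, Matrix.submatrix_mul_equiv, ← hsp]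
    simp

lemma lamVec_unique {n : ℕ} {X U : Matrix (Fin n) (Fin n) ℝ} {a : Fin n → ℝ} (hX : X.IsSymm)
    (hU : Uᵀ * U = 1) (h : X = U * Matrix.diagonal a * Uᵀ) (ha : Antitone a) : lamVec X = a := by
  obtain ⟨V, hV, hVX⟩ := exists_OSet hX
  have key : ∀ (W : Matrix (Fin n) (Fin n) ℝ) (b : Fin n → ℝ), Wᵀ * W = 1 →
      X = W * Matrix.diagonal b * Wᵀ → X.charpoly.roots = Multiset.map b Finset.univ.val := by
    intro W b hW hb
    have : X.charpoly = ∏ i, (Polynomial.X - Polynomial.C (b i)) := by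
      rw [hb, Matrix.charpoly_mul_comm, ← mul_assoc, hW, one_mul, Matrix.charpoly_diagonal]
    rw [this, Polynomial.roots_prod]
    · simp
    · simp [Finset.prod_ne_zero_iff, Polynomial.X_sub_C_ne_zero]
  have h1 := (key V _ hV hVX).symm.trans (key U a hU h)
  have h2 : (List.ofFn (lamVec X)).Perm (List.ofFn a) := by
    rw [← Multiset.coe_eq_coe]
    simpa [Fin.univ_val_map] using h1
  have h3 : List.ofFn (lamVec X) = List.ofFn a := by
    apply h2.eq_of_pairwise (le := (· ≥ ·))
    · intro x y _ _ h1 h2; exact le_antisymm h2 h1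
    · rw [List.pairwise_ofFn]; intro i j hij; exact lamVec_antitone X hij.le
    · rw [List.pairwise_ofFn]; intro i j hij; exact ha hij.le
  exact List.ofFn_injective h3

lemma quad_conj {n : ℕ} (U A : Matrix (Fin n) (Fin n) ℝ) (z : Fin n → ℝ) :
    z ⬝ᵥ (U * A * Uᵀ) *ᵥ z = (Uᵀ *ᵥ z) ⬝ᵥ A *ᵥ (Uᵀ *ᵥ z) := by
  rw [← Matrix.mulVec_mulVec, ← Matrix.mulVec_mulVec, Matrix.dotProduct_mulVec z U,
    Matrix.mulVec_transpose]

lemma norm_conj {n : ℕ} {U : Matrix (Fin n) (Fin n) ℝ} (hU : Uᵀ * U = 1) (z : Fin n → ℝ) :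
    (Uᵀ *ᵥ z) ⬝ᵥ (Uᵀ *ᵥ z) = z ⬝ᵥ z := by
  have h := quad_conj U 1 z
  rw [mul_one, mul_eq_one_comm.mp hU] at h
  simpa using h.symm

lemma quad_diag {n : ℕ} (a z : Fin n → ℝ) :
    z ⬝ᵥ (Matrix.diagonal a) *ᵥ z = ∑ i, a i * z i ^ 2 := by
  simp only [dotProduct, Matrix.mulVec_diagonal]
  exact Finset.sum_congr rfl fun i _ => by ring

lemma lam_quad_le {n : ℕ} [NeZero n] {X : Matrix (Fin n) (Fin n) ℝ} (hX : X.IsSymm)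
    (z : Fin n → ℝ) : z ⬝ᵥ X *ᵥ z ≤ lamVec X 0 * (z ⬝ᵥ z) := by
  obtain ⟨U, hU, h⟩ := exists_OSet hX
  have h1 : z ⬝ᵥ X *ᵥ z = ∑ i, lamVec X i * (Uᵀ *ᵥ z) i ^ 2 := by
    rw [← quad_diag, ← quad_conj, ← h]
  rw [h1, ← norm_conj hU z, dotProduct, Finset.mul_sum]
  apply Finset.sum_le_sum
  intro i _
  rw [← sq]
  exact mul_le_mul_of_nonneg_right (lamVec_antitone X (Fin.zero_le i)) (sq_nonneg _)

lemma lam_exists_eig {n : ℕ} [NeZero n] {X : Matrix (Fin n) (Fin n) ℝ} (hX : X.IsSymm) :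
    ∃ z : Fin n → ℝ, z ⬝ᵥ z = 1 ∧ X *ᵥ z = lamVec X 0 • z := by
  obtain ⟨U, hU, h⟩ := exists_OSet hX
  refine ⟨U *ᵥ Pi.single 0 1, ?_, ?_⟩
  · rw [← norm_conj hU, Matrix.mulVec_mulVec, hU, Matrix.one_mulVec]; simp
  · have h2 : X * U = U * Matrix.diagonal (lamVec X) := by
      conv_lhs => rw [h, mul_assoc, hU, mul_one]
    rw [Matrix.mulVec_mulVec, h2, ← Matrix.mulVec_mulVec, ← Matrix.mulVec_smul]
    congr 1
    ext i
    simp [Matrix.mulVec_diagonal, Pi.single_apply]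
    split_ifs with hi
    · rw [hi]
    · rfl

lemma lam_le_of {n : ℕ} [NeZero n] {X : Matrix (Fin n) (Fin n) ℝ} (hX : X.IsSymm) {c : ℝ}
    (h : ∀ z : Fin n → ℝ, z ⬝ᵥ X *ᵥ z ≤ c * (z ⬝ᵥ z)) : lamVec X 0 ≤ c := by
  obtain ⟨z, hz, hz2⟩ := lam_exists_eig hX
  have := h z
  rw [hz2, hz, dotProduct_smul, hz] at this
  simpa using this

lemma lam_le_of_conj {n : ℕ} [NeZero n] {X U : Matrix (Fin n) (Fin n) ℝ} (hX : X.IsSymm) {c : ℝ}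
    (hU : Uᵀ * U = 1)
    (h : ∀ z : Fin n → ℝ, z ⬝ᵥ (Uᵀ * X * U) *ᵥ z ≤ c * (z ⬝ᵥ z)) : lamVec X 0 ≤ c := by
  apply lam_le_of hX
  intro z
  have h1 : X = U * (Uᵀ * X * U) * Uᵀ := by
    have := mul_eq_one_comm.mp hU
    calc X = (U * Uᵀ) * X * (U * Uᵀ) := by rw [this]; simp
      _ = _ := by simp only [mul_assoc]
  rw [← norm_conj hU z]
  conv_lhs => rw [h1, quad_conj]
  exact h _

/-- positive semidefinite and trace one form. -/
lemma msub_forward {n : ℕ} [NeZero n] {X Y : Matrix (Fin n) (Fin n) ℝ} (hX : X.IsSymm)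
    (h : Y ∈ msubdiff (fun X => lamVec X 0) X) :
    Y.IsSymm ∧ (∀ z : Fin n → ℝ, 0 ≤ z ⬝ᵥ Y *ᵥ z) ∧ Y.trace = 1 ∧ mip Y X = lamVec X 0 := by
  obtain ⟨hY, h⟩ := h
  have hmip : ∀ A B : Matrix (Fin n) (Fin n) ℝ, mip Y (A + B) = mip Y A + mip Y B := by
    intro A B; simp [mip, mul_add]
  have hmips : ∀ (c : ℝ) (A : Matrix (Fin n) (Fin n) ℝ), mip Y (c • A) = c * mip Y A := by
    intro A B; simp [mip]
  have hIs : (1 : Matrix (Fin n) (Fin n) ℝ).IsSymm := Matrix.isSymm_one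
  have htr : ∀ t : ℝ, t * Y.trace ≤ t := by
    intro t
    have h1 := h (X + t • 1) (hX.add (hIs.smul t))
    have h2 : lamVec (X + t • (1 : Matrix (Fin n) (Fin n) ℝ)) 0 ≤ lamVec X 0 + t := by
      apply lam_le_of (hX.add (hIs.smul t))
      intro z
      rw [Matrix.add_mulVec, dotProduct_add, Matrix.smul_mulVec, Matrix.one_mulVec,
        dotProduct_smul, smul_eq_mul, add_mul]
      linarith [lam_quad_le hX z]
    rw [add_sub_cancel_left, hmips] at h1
    have h3 : mip Y 1 = Y.trace := by simp [mip]
    rw [h3] at h1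
    linarith
  refine ⟨hY, ?_, ?_, ?_⟩
  · intro z
    have hs : (Matrix.vecMulVec z z).IsSymm := by
      ext i j; simp [Matrix.vecMulVec, mul_comm]
    have h1 := h (X + (-1 : ℝ) • Matrix.vecMulVec z z) (hX.add (hs.smul _))
    have h2 : lamVec (X + (-1 : ℝ) • Matrix.vecMulVec z z) 0 ≤ lamVec X 0 := by
      apply lam_le_of (hX.add (hs.smul _))
      intro y
      rw [Matrix.add_mulVec, dotProduct_add, Matrix.smul_mulVec,
        dotProduct_smul, smul_eq_mul]
      have : y ⬝ᵥ (Matrix.vecMulVec z z) *ᵥ y = (z ⬝ᵥ y) ^ 2 := by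
        rw [Matrix.vecMulVec_mulVec, dotProduct_smul]
        simp [dotProduct_comm y z]; ring
      rw [this]
      nlinarith [lam_quad_le hX y, sq_nonneg (z ⬝ᵥ y)]
    rw [add_sub_cancel_left, hmips] at h1
    have h3 : mip Y (Matrix.vecMulVec z z) = z ⬝ᵥ Y *ᵥ z := by
      rw [mip, hY, Matrix.mul_vecMulVec, Matrix.trace_vecMulVec, dotProduct_comm]
    rw [h3] at h1
    linarith
  · have := htr 1; have := htr (-1); linarith
  · have hz : lamVec (0 : Matrix (Fin n) (Fin n) ℝ) 0 ≤ 0 :=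
      lam_le_of Matrix.isSymm_zero (by simp)
    have h1 := h 0 Matrix.isSymm_zero
    have h2 := h ((2 : ℝ) • X) (hX.smul _)
    have h3 : lamVec ((2 : ℝ) • X) 0 ≤ 2 * lamVec X 0 := by
      apply lam_le_of (hX.smul _)
      intro z
      rw [Matrix.smul_mulVec, dotProduct_smul, smul_eq_mul]
      linarith [lam_quad_le hX z]
    have e1 : (0 : Matrix (Fin n) (Fin n) ℝ) - X = (-1 : ℝ) • X := by simp
    have e2 : (2 : ℝ) • X - X = (1 : ℝ) • X := by
      rw [two_smul, one_smul]; simp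
    rw [e1, hmips] at h1
    rw [e2, hmips] at h2
    simp only at h1 h2
    linarith

/-- trace pairing of a PSD matrix. -/
lemma mip_nonneg {n : ℕ} {Y A : Matrix (Fin n) (Fin n) ℝ} (hY : Y.IsSymm)
    (hp : ∀ z : Fin n → ℝ, 0 ≤ z ⬝ᵥ Y *ᵥ z) (hA : ∀ z : Fin n → ℝ, 0 ≤ z ⬝ᵥ A *ᵥ z) :
    0 ≤ mip Y A := by
  obtain ⟨U, hU, h⟩ := exists_OSet hY
  have hl : ∀ i, 0 ≤ lamVec Y i := by
    intro i
    have h1 := hp (U *ᵥ Pi.single i 1)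
    conv at h1 => rw [h]
    rw [quad_conj, Matrix.mulVec_mulVec, hU, Matrix.one_mulVec, quad_diag] at h1
    simpa [Pi.single_apply] using h1
  have h2 : mip Y A = ∑ i, lamVec Y i * ((fun k => U k i) ⬝ᵥ A *ᵥ (fun k => U k i)) := by
    rw [mip, hY]
    conv_lhs => rw [h]
    rw [mul_assoc, mul_assoc, Matrix.trace_mul_comm, mul_assoc, Matrix.trace]
    apply Finset.sum_congr rfl
    intro i _
    rw [Matrix.diag_apply, Matrix.diagonal_mul, mul_assoc]
    congr 1
  rw [h2]
  exact Finset.sum_nonneg fun i _ => mul_nonneg (hl i) (hA _)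

lemma msub_backward {n : ℕ} [NeZero n] {X Y : Matrix (Fin n) (Fin n) ℝ}
    (hY : Y.IsSymm) (hp : ∀ z : Fin n → ℝ, 0 ≤ z ⬝ᵥ Y *ᵥ z) (htr : Y.trace = 1)
    (h : mip Y X = lamVec X 0) : Y ∈ msubdiff (fun X => lamVec X 0) X := by
  refine ⟨hY, fun Z hZ => ?_⟩
  have h1 : 0 ≤ mip Y (lamVec Z 0 • 1 - Z) := by
    apply mip_nonneg hY hp
    intro z
    rw [Matrix.sub_mulVec, dotProduct_sub, Matrix.smul_mulVec, Matrix.one_mulVec,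
        dotProduct_smul, smul_eq_mul]
    linarith [lam_quad_le hZ z]
  have h2 : mip Y (lamVec Z 0 • 1 - Z) = lamVec Z 0 * Y.trace - mip Y Z := by
    simp [mip, mul_sub]
  have h3 : mip Y (Z - X) = mip Y Z - mip Y X := by
    simp [mip, mul_sub]
  rw [h2, htr] at h1
  simp only [h3, h]
  linarith

lemma lam_ge_mip {n : ℕ} [NeZero n] {Z Y : Matrix (Fin n) (Fin n) ℝ} (hZ : Z.IsSymm)
    (hY : Y.IsSymm) (hp : ∀ z : Fin n → ℝ, 0 ≤ z ⬝ᵥ Y *ᵥ z) (htr : Y.trace = 1) :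
    mip Y Z ≤ lamVec Z 0 := by
  have h1 : 0 ≤ mip Y (lamVec Z 0 • 1 - Z) := by
    apply mip_nonneg hY hp
    intro z
    rw [Matrix.sub_mulVec, dotProduct_sub, Matrix.smul_mulVec, Matrix.one_mulVec,
        dotProduct_smul, smul_eq_mul]
    linarith [lam_quad_le hZ z]
  have h2 : mip Y (lamVec Z 0 • 1 - Z) = lamVec Z 0 * Y.trace - mip Y Z := by
    simp [mip, mul_sub]
  rw [h2, htr] at h1
  linarith

lemma psd_ker {n : ℕ} {D : Matrix (Fin n) (Fin n) ℝ} (hD : D.IsSymm)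
    (hp : ∀ z : Fin n → ℝ, 0 ≤ z ⬝ᵥ D *ᵥ z) {z : Fin n → ℝ} (hz : z ⬝ᵥ D *ᵥ z = 0) :
    D *ᵥ z = 0 := by
  have h : D.PosSemidef := Matrix.PosSemidef.of_dotProduct_mulVec_nonneg (aux_herm hD)
    (by intro x; simpa using hp x)
  rw [← h.dotProduct_mulVec_zero_iff]
  simpa using hz

lemma psd_eigs {n : ℕ} {Y U : Matrix (Fin n) (Fin n) ℝ} {w : Fin n → ℝ}
    (hp : ∀ z : Fin n → ℝ, 0 ≤ z ⬝ᵥ Y *ᵥ z) (hU : Uᵀ * U = 1)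
    (h : Y = U * Matrix.diagonal w * Uᵀ) (i : Fin n) : 0 ≤ w i := by
  have h1 := hp (U *ᵥ Pi.single i 1)
  conv at h1 => rw [h]
  rw [quad_conj, Matrix.mulVec_mulVec, hU, Matrix.one_mulVec, quad_diag] at h1
  simpa [Pi.single_apply] using h1

lemma mip_diag {n : ℕ} {Y A U : Matrix (Fin n) (Fin n) ℝ} {w : Fin n → ℝ} (hY : Y.IsSymm)
    (h : Y = U * Matrix.diagonal w * Uᵀ) : mip Y A = ∑ i, w i * (Uᵀ * A * U) i i := by
  rw [mip, hY]
  conv_lhs => rw [h]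
  rw [mul_assoc, mul_assoc, Matrix.trace_mul_comm, mul_assoc, Matrix.trace]
  apply Finset.sum_congr rfl
  intro i _
  rw [Matrix.diag_apply, Matrix.diagonal_mul]

lemma diag_entry {n : ℕ} (A U : Matrix (Fin n) (Fin n) ℝ) (i j : Fin n) :
    (Uᵀ * A * U) i j = (U *ᵥ Pi.single i 1) ⬝ᵥ A *ᵥ (U *ᵥ Pi.single j 1) := by
  have : (Uᵀ * A * U) i j = Pi.single i 1 ⬝ᵥ (Uᵀ * A * U) *ᵥ (Pi.single j 1) := by
    simp
  rw [this, ← Matrix.mulVec_mulVec, ← Matrix.mulVec_mulVec, Matrix.dotProduct_mulVec _ Uᵀ,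
    Matrix.vecMul_transpose]

lemma mul_eq_lam {n : ℕ} [NeZero n] {X Y : Matrix (Fin n) (Fin n) ℝ} (hX : X.IsSymm)
    (hY : Y.IsSymm) (hp : ∀ z : Fin n → ℝ, 0 ≤ z ⬝ᵥ Y *ᵥ z) (htr : Y.trace = 1)
    (h : mip Y X = lamVec X 0) : X * Y = lamVec X 0 • Y := by
  obtain ⟨U, hU, hUY⟩ := exists_OSet hY
  set D : Matrix (Fin n) (Fin n) ℝ := lamVec X 0 • 1 - X with hD
  have hDs : D.IsSymm := (Matrix.isSymm_one.smul _).sub hX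
  have hDp : ∀ z : Fin n → ℝ, 0 ≤ z ⬝ᵥ D *ᵥ z := by
    intro z
    rw [hD, Matrix.sub_mulVec, dotProduct_sub, Matrix.smul_mulVec, Matrix.one_mulVec,
        dotProduct_smul, smul_eq_mul]
    linarith [lam_quad_le hX z]
  have h0 : mip Y D = 0 := by
    have h2 : mip Y D = lamVec X 0 * Y.trace - mip Y X := by
      simp [hD, mip, mul_sub]
    rw [h2, htr, h]; ring
  have hw := psd_eigs hp hU hUY
  rw [mip_diag hY hUY, Finset.sum_eq_zero_iff_of_nonneg] at h0
  · have hcol : D * U * Matrix.diagonal (lamVec Y) = 0 := by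
      ext i j
      rw [Matrix.mul_diagonal]
      rcases mul_eq_zero.mp (h0 j (Finset.mem_univ j)) with h1 | h1
      · simp [h1]
      · rw [diag_entry] at h1
        have h2 := psd_ker hDs hDp h1
        rw [Matrix.mulVec_mulVec] at h2
        have h3 := congrFun h2 i
        simp at h3
        simp [h3]
    have : D * Y = 0 := by
      conv_lhs => rw [hUY, ← mul_assoc, ← mul_assoc, hcol, zero_mul]
    rw [hD, sub_mul, sub_eq_zero] at this
    rw [← this]; simp
  · intro i _
    refine mul_nonneg (hw i) ?_
    rw [diag_entry]; exact hDp _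

/-- simultaneous ordered diagonalization -/
lemma exists_joint {n : ℕ} [NeZero n] {X Y : Matrix (Fin n) (Fin n) ℝ} (hX : X.IsSymm)
    (hY : Y.IsSymm) (hp : ∀ z : Fin n → ℝ, 0 ≤ z ⬝ᵥ Y *ᵥ z) (htr : Y.trace = 1)
    (h : mip Y X = lamVec X 0) : ∃ U, U ∈ OSet X ∩ OSet Y := by
  have hXY := mul_eq_lam hX hY hp htr h
  have hYX : Y * X = lamVec X 0 • Y := by
    have := congrArg Matrix.transpose hXY
    rwa [Matrix.transpose_mul, Matrix.transpose_smul, hX, hY] at this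
  obtain ⟨V, hV, hVM⟩ := exists_OSet (hX.add hY)
  set v := lamVec X 0 with hv
  -- each column is a joint eigenvector
  have hMV : (X + Y) * V = V * Matrix.diagonal (lamVec (X + Y)) := by
    conv_lhs => rw [hVM, mul_assoc, hV, mul_one]
  have hjoint : ∀ i, ∃ a b : ℝ, X *ᵥ (V *ᵥ Pi.single i 1) = a • (V *ᵥ Pi.single i 1) ∧
      Y *ᵥ (V *ᵥ Pi.single i 1) = b • (V *ᵥ Pi.single i 1) ∧ 0 ≤ b ∧ a ≤ v ∧ (0 < b → a = v) := by
    intro i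
    set u : Fin n → ℝ := V *ᵥ Pi.single i 1 with hu
    set μ := lamVec (X + Y) i with hμ
    have huu : u ⬝ᵥ u = 1 := by
      rw [← norm_conj hV, hu, Matrix.mulVec_mulVec, hV, Matrix.one_mulVec]; simp
    have hMu : X *ᵥ u + Y *ᵥ u = μ • u := by
      rw [← Matrix.add_mulVec, hu, Matrix.mulVec_mulVec, hMV, ← Matrix.mulVec_mulVec,
        ← Matrix.mulVec_smul]
      congr 1
      ext j
      simp [Matrix.mulVec_diagonal, Pi.single_apply]
      split_ifs with hi
      · rw [hi]
      · rfl
    set p := Y *ᵥ u with hpdef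
    have hXp : X *ᵥ p = v • p := by
      rw [hpdef, Matrix.mulVec_mulVec, hXY, Matrix.smul_mulVec]
    have hYp : Y *ᵥ p = (μ - v) • p := by
      have h1 := congrArg (fun z => Y *ᵥ z) hMu
      simp only [Matrix.mulVec_add, Matrix.mulVec_smul] at h1
      rw [Matrix.mulVec_mulVec, hYX, Matrix.smul_mulVec, ← hpdef] at h1
      rw [sub_smul, ← h1]; simp
    have hle : ∀ a : ℝ, X *ᵥ u = a • u → a ≤ v := by
      intro a ha
      have := lam_quad_le hX u
      rw [ha, dotProduct_smul, huu] at this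
      simpa using this
    by_cases hp0 : p = 0
    · refine ⟨μ, 0, ?_, ?_, le_rfl, ?_, fun h => absurd h (lt_irrefl _)⟩
      · rw [hp0, add_zero] at hMu; exact hMu
      · rw [hp0]; simp
      · apply hle; rw [hp0, add_zero] at hMu; exact hMu
    · have hpp : 0 < p ⬝ᵥ p := by
        rcases lt_or_eq_of_le (Finset.sum_nonneg (fun i _ => mul_self_nonneg (p i)) :
          0 ≤ p ⬝ᵥ p) with h1 | h1
        · exact h1
        · exact absurd (dotProduct_self_eq_zero.mp h1.symm) hp0
      have hge : 0 ≤ μ - v := by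
        have h1 := hp p
        rw [hYp, dotProduct_smul, smul_eq_mul] at h1
        by_contra hc
        nlinarith
      have hne : μ - v ≠ 0 := by
        intro h0
        rw [h0, zero_smul, hpdef] at hYp
        have h1 : p ⬝ᵥ p = u ⬝ᵥ Y *ᵥ (Y *ᵥ u) := by
          rw [Matrix.dotProduct_mulVec u Y, ← Matrix.mulVec_transpose, hY]
        rw [h1, hYp] at hpp
        simp at hpp
      have hgt : 0 < μ - v := lt_of_le_of_ne hge (Ne.symm hne)
      set r := u - (μ - v)⁻¹ • p with hr
      have hYr : Y *ᵥ r = 0 := by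
        rw [hr, Matrix.mulVec_sub, Matrix.mulVec_smul, hYp, smul_smul, inv_mul_cancel₀ hne,
          one_smul, ← hpdef, sub_self]
      have hXr : X *ᵥ r = μ • r := by
        have h1 : X *ᵥ u = μ • u - p := by rw [← hMu]; simp
        rw [hr, Matrix.mulVec_sub, Matrix.mulVec_smul, hXp, h1]
        ext j
        simp only [Pi.sub_apply, Pi.smul_apply, smul_eq_mul]
        field_simp
        ring
      have hr0 : r = 0 := by
        have h1 := lam_quad_le hX r
        rw [hXr, dotProduct_smul, smul_eq_mul, ← hv] at h1
        have h2 : 0 ≤ r ⬝ᵥ r := Finset.sum_nonneg (fun i _ => mul_self_nonneg (r i))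
        apply dotProduct_self_eq_zero.mp
        nlinarith
      have hpu : p = (μ - v) • u := by
        have h1 : u = (μ - v)⁻¹ • p := sub_eq_zero.mp hr0
        rw [h1, smul_smul, mul_inv_cancel₀ hne, one_smul]
      have hXu : X *ᵥ u = v • u := by
        have h1 : X *ᵥ u = μ • u - p := by rw [← hMu]; simp
        rw [h1, hpu, ← sub_smul]; congr 1; ring
      exact ⟨v, μ - v, hXu, hpu, hge, le_rfl, fun _ => rfl⟩
  choose a b hXa hYb hb ha hab using hjoint
  -- sort by a + b
  let e : Equiv.Perm (Fin n) := Tuple.sort (fun i => -(a i + b i))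
  have he : ∀ i j, i ≤ j → a (e j) + b (e j) ≤ a (e i) + b (e i) := by
    intro i j hij
    have := Tuple.monotone_sort (fun i => -(a i + b i)) hij
    simp only [Function.comp] at this
    change -(a (e i) + b (e i)) ≤ -(a (e j) + b (e j)) at this
    linarith
  have haa : Antitone (a ∘ e) := by
    intro i j hij
    have h1 := he i j hij
    simp only [Function.comp]
    rcases (hb (e i)).lt_or_eq with h2 | h2
    · rw [hab _ h2]; exact ha _
    · have := hb (e j); linarith
  have hbb : Antitone (b ∘ e) := by
    intro i j hij
    have h1 := he i j hij
    simp only [Function.comp]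
    rcases (hb (e j)).lt_or_eq with h2 | h2
    · have h3 := hab _ h2; have := ha (e i); linarith
    · rw [← h2]; exact hb _
  set U := V.submatrix id e with hUdef
  have hU : Uᵀ * U = 1 := by
    rw [hUdef, Matrix.transpose_submatrix]
    have h2 := Matrix.submatrix_mul_equiv Vᵀ V e (Equiv.refl _) e
    rw [hV, Matrix.submatrix_one_equiv] at h2
    exact h2
  have hUU := mul_eq_one_comm.mp hU
  have main : ∀ (Z : Matrix (Fin n) (Fin n) ℝ) (c : Fin n → ℝ),
      (∀ i, Z *ᵥ (V *ᵥ Pi.single i 1) = c i • (V *ᵥ Pi.single i 1)) →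
      Z = U * Matrix.diagonal (c ∘ e) * Uᵀ := by
    intro Z c hc
    have h1 : Z * U = U * Matrix.diagonal (c ∘ e) := by
      ext i j
      rw [Matrix.mul_diagonal]
      have h2 := congrFun (hc (e j)) i
      rw [Matrix.mulVec_mulVec] at h2
      simp at h2
      simp only [hUdef, Matrix.submatrix_apply, id, Function.comp]
      rw [mul_comm, ← h2]
      simp [Matrix.mul_apply]
    rw [← h1, mul_assoc, hUU, mul_one]
  have m1 := main X a hXa
  have m2 := main Y b hYb
  refine ⟨U, ⟨hU, ?_⟩, ⟨hU, ?_⟩⟩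
  · rw [lamVec_unique hX hU m1 haa]; exact m1
  · rw [lamVec_unique hY hU m2 hbb]; exact m2

lemma mp_unique {n : ℕ} {A B C : Matrix (Fin n) (Fin n) ℝ}
    (hB : A * B * A = A ∧ B * A * B = B ∧ (A * B)ᵀ = A * B ∧ (B * A)ᵀ = B * A)
    (hC : A * C * A = A ∧ C * A * C = C ∧ (A * C)ᵀ = A * C ∧ (C * A)ᵀ = C * A) : B = C := by
  obtain ⟨b1, b2, b3, b4⟩ := hB
  obtain ⟨c1, c2, c3, c4⟩ := hC
  have h1 : A * B = A * C := by
    have : A * B = (A * C) * (A * B) := by rw [← mul_assoc, c1]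
    have h2 := congrArg Matrix.transpose this
    rw [Matrix.transpose_mul (A * C), b3, c3, ← mul_assoc, b1] at h2
    exact h2
  have h3 : B * A = C * A := by
    have : B * A = (B * A) * (C * A) := by rw [mul_assoc, ← mul_assoc A, c1]
    have h2 := congrArg Matrix.transpose this
    rw [Matrix.transpose_mul (B * A), b4, c4, mul_assoc, ← mul_assoc A, b1] at h2
    exact h2
  calc B = B * A * B := b2.symm
    _ = C * A * C := by rw [h3, mul_assoc, h1, ← mul_assoc]
    _ = C := c2

lemma mpInv_diag {n : ℕ} {A U : Matrix (Fin n) (Fin n) ℝ} {a : Fin n → ℝ} (hU : Uᵀ * U = 1)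
    (h : A = U * Matrix.diagonal a * Uᵀ) :
    mpInv A = U * Matrix.diagonal (fun i => (a i)⁻¹) * Uᵀ := by
  have hm : ∀ b c : Fin n → ℝ, (U * Matrix.diagonal b * Uᵀ) * (U * Matrix.diagonal c * Uᵀ) =
      U * Matrix.diagonal (fun i => b i * c i) * Uᵀ := by
    intro b c
    calc _ = U * Matrix.diagonal b * (Uᵀ * U) * Matrix.diagonal c * Uᵀ := by
          simp only [mul_assoc]
      _ = _ := by rw [hU, mul_one, mul_assoc U, Matrix.diagonal_mul_diagonal]
  have ht : ∀ b : Fin n → ℝ, (U * Matrix.diagonal b * Uᵀ)ᵀ = U * Matrix.diagonal b * Uᵀ := by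
    intro b
    simp [Matrix.transpose_mul, mul_assoc]
  have hP : (fun B => A * B * A = A ∧ B * A * B = B ∧ (A * B)ᵀ = A * B ∧ (B * A)ᵀ = B * A)
      (U * Matrix.diagonal (fun i => (a i)⁻¹) * Uᵀ) := by
    rw [h]
    simp only [hm, ht]
    have e2 : (fun i => (a i)⁻¹ * a i * (a i)⁻¹) = fun i => (a i)⁻¹ := by
      funext i; by_cases h0 : a i = 0 <;> simp [h0]
    simp [mul_inv_mul_cancel, e2]
  exact mp_unique (Classical.epsilon_spec (p := fun B => A * B * A = A ∧ B * A * B = B ∧ (A * B)ᵀ = A * B ∧ (B * A)ᵀ = B * A) ⟨_, hP⟩) hP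

/-- the value of the sigma term in coordinates -/
lemma upsilon_eq {n : ℕ} [NeZero n] {X Y U H : Matrix (Fin n) (Fin n) ℝ}
    (hH : H.IsSymm) (hUX : U ∈ OSet X) 
    (hv : ∀ i, lamVec Y i ≠ 0 → lamVec X i = lamVec X 0) :
    Upsilon X Y U H = - (2 * ∑ i, lamVec Y i *
      ∑ l, (Uᵀ * H * U) i l ^ 2 * (lamVec X 0 - lamVec X l)⁻¹) := by
  obtain ⟨hU, hX⟩ := hUX
  have hUU := mul_eq_one_comm.mp hU
  have hD : X - lamVec X 0 • (1 : Matrix (Fin n) (Fin n) ℝ) =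
      U * Matrix.diagonal (fun i => lamVec X i - lamVec X 0) * Uᵀ := by
    have h1 : Matrix.diagonal (fun i => lamVec X i - lamVec X 0) =
        Matrix.diagonal (lamVec X) - lamVec X 0 • (1 : Matrix (Fin n) (Fin n) ℝ) := by
      ext i j
      by_cases hij : i = j
      · subst hij; simp
      · simp [hij]
    rw [h1, mul_sub, sub_mul, ← hX]
    simp [hUU]
  have hinv := mpInv_diag hU hD
  rw [Upsilon, ← mul_neg, ← Finset.sum_neg_distrib]
  congr 1
  apply Finset.sum_congr rfl
  intro i _
  by_cases hi : lamVec Y i = 0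
  · simp [hi]
  · rw [hv i hi, hinv, ← mul_neg]
    congr 1
    have e : Uᵀ * H * (U * Matrix.diagonal (fun i => (lamVec X i - lamVec X 0)⁻¹) * Uᵀ) * H * U =
        (Uᵀ * H * U) * Matrix.diagonal (fun i => (lamVec X i - lamVec X 0)⁻¹) * (Uᵀ * H * U) := by
      simp only [mul_assoc]
    have hs : ∀ i j, (Uᵀ * H * U) j i = (Uᵀ * H * U) i j := by
      have : (Uᵀ * H * U)ᵀ = Uᵀ * H * U := by
        simp only [Matrix.transpose_mul, Matrix.transpose_transpose, hH.eq, mul_assoc]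
      intro i j
      exact congrFun (congrFun this i) j
    rw [e, Matrix.mul_apply, ← Finset.sum_neg_distrib]
    apply Finset.sum_congr rfl
    intro l _
    rw [Matrix.mul_diagonal, hs i l, ← neg_sub (lamVec X 0), inv_neg]
    ring

lemma lam_convex {n : ℕ} [NeZero n] {X H : Matrix (Fin n) (Fin n) ℝ} (hX : X.IsSymm)
    (hH : H.IsSymm) : ConvexOn ℝ Set.univ (fun t : ℝ => lamVec (X + t • H) 0) := by
  refine ⟨convex_univ, ?_⟩
  intro s _ t _ a b ha hb hab
  apply lam_le_of (hX.add (hH.smul _))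
  intro z
  have h1 := lam_quad_le (hX.add (hH.smul s)) z
  have h2 := lam_quad_le (hX.add (hH.smul t)) z
  simp only [Matrix.add_mulVec, dotProduct_add, Matrix.smul_mulVec, dotProduct_smul,
    smul_eq_mul] at h1 h2 ⊢
  have h3 := mul_le_mul_of_nonneg_left h1 ha
  have h4 := mul_le_mul_of_nonneg_left h2 hb
  have h5 : z ⬝ᵥ X *ᵥ z = a * (z ⬝ᵥ X *ᵥ z) + b * (z ⬝ᵥ X *ᵥ z) := by
    rw [← add_mul, hab, one_mul]
  rw [h5]
  linarith

/-- the directional derivative dominates the Rayleigh quotients on the top eigenspace -/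
lemma dirDeriv_ge {n : ℕ} [NeZero n] {X H : Matrix (Fin n) (Fin n) ℝ} (hX : X.IsSymm)
    (hH : H.IsSymm) {q : Fin n → ℝ} (hq : X *ᵥ q = lamVec X 0 • q) :
    q ⬝ᵥ H *ᵥ q ≤ dirDeriv (fun X => lamVec X 0) X H * (q ⬝ᵥ q) := by
  have hc := lam_convex hX hH
  have hd := (hc.differentiableWithinAt_Ioi_of_mem_interior (x := 0) (by simp)).hasDerivWithinAt
  set c := derivWithin (fun t : ℝ => lamVec (X + t • H) 0) (Ioi 0) 0
  rw [hasDerivWithinAt_iff_tendsto_slope' (by simp)] at hd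
  have hd2 : Tendsto (fun t : ℝ => (lamVec (X + t • H) 0 - lamVec X 0) / t) (𝓝[>] 0) (𝓝 c) := by
    refine hd.congr ?_
    intro t
    simp [slope_def_field]
  have hdir : dirDeriv (fun X => lamVec X 0) X H = c := hd2.limUnder_eq
  rw [hdir]
  have hqq : 0 ≤ q ⬝ᵥ q := Finset.sum_nonneg (fun i _ => mul_self_nonneg (q i))
  refine ge_of_tendsto (hd2.mul_const (q ⬝ᵥ q)) ?_
  filter_upwards [self_mem_nhdsWithin] with t ht
  have ht : 0 < t := ht
  have h1 := lam_quad_le (hX.add (hH.smul t)) q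
  simp only [Matrix.add_mulVec, dotProduct_add, Matrix.smul_mulVec, dotProduct_smul,
    smul_eq_mul, hq] at h1
  rw [div_mul_eq_mul_div, le_div_iff₀ ht]
  linarith

/-- block structure of a matrix in the affine hull of the critical cone -/
lemma crit_block {n : ℕ} [NeZero n] {X Y U H : Matrix (Fin n) (Fin n) ℝ} (hX : X.IsSymm)
    (hY : Y.IsSymm) (hp : ∀ z : Fin n → ℝ, 0 ≤ z ⬝ᵥ Y *ᵥ z) (htr : Y.trace = 1)
    (hUX : U ∈ OSet X) (hUY : U ∈ OSet Y) (hv : ∀ i, lamVec Y i ≠ 0 → lamVec X i = lamVec X 0)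
    (hH : H ∈ affineSpan ℝ {H : Matrix (Fin n) (Fin n) ℝ |
          H.IsSymm ∧ dirDeriv (fun X => lamVec X 0) X H = mip Y H}) :
    ∀ i j, lamVec Y i ≠ 0 → lamVec X j = lamVec X 0 →
      (Uᵀ * H * U) i j = if i = j then mip Y H else 0 := by
  have hU := hUX.1
  have hw := psd_eigs hp hU hUY.2
  have hsum : ∑ i, lamVec Y i = 1 := by
    have h1 := mip_diag (A := 1) hY hUY.2
    have h2 : mip Y 1 = 1 := by simp [mip, htr]
    rw [h2] at h1
    rw [h1]
    simp [hU]
  let S : Submodule ℝ (Matrix (Fin n) (Fin n) ℝ) :=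
    { carrier := {H | ∀ i j, lamVec Y i ≠ 0 → lamVec X j = lamVec X 0 →
        (Uᵀ * H * U) i j = if i = j then mip Y H else 0}
      add_mem' := by
        intro A B hA hB i j hi hj
        have : mip Y (A + B) = mip Y A + mip Y B := by simp [mip, mul_add]
        rw [mul_add, add_mul, Matrix.add_apply, hA i j hi hj, hB i j hi hj, this]
        split_ifs <;> simp
      zero_mem' := by
        intro i j _ _
        simp [mip]
      smul_mem' := by
        intro c A hA i j hi hj
        have : mip Y (c • A) = c * mip Y A := by simp [mip]
        rw [Matrix.mul_smul, Matrix.smul_mul, Matrix.smul_apply, hA i j hi hj, this]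
        split_ifs <;> simp }
  have hle : affineSpan ℝ {H : Matrix (Fin n) (Fin n) ℝ |
          H.IsSymm ∧ dirDeriv (fun X => lamVec X 0) X H = mip Y H} ≤ S.toAffineSubspace := by
    rw [affineSpan_le]
    rintro H ⟨hHs, hHd⟩
    change ∀ i j, lamVec Y i ≠ 0 → lamVec X j = lamVec X 0 →
        (Uᵀ * H * U) i j = if i = j then mip Y H else 0
    have hXU : X * U = U * Matrix.diagonal (lamVec X) := by
      conv_lhs => rw [hUX.2, mul_assoc, hU, mul_one]
    have heig : ∀ j, lamVec X j = lamVec X 0 →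
        X *ᵥ (U *ᵥ Pi.single j 1) = lamVec X 0 • (U *ᵥ Pi.single j 1) := by
      intro j hj
      rw [Matrix.mulVec_mulVec, hXU, ← Matrix.mulVec_mulVec, ← Matrix.mulVec_smul]
      congr 1
      ext k
      simp [Matrix.mulVec_diagonal, Pi.single_apply]
      split_ifs with hi
      · rw [hi, hj]
      · rfl
    have hon : ∀ i j, (U *ᵥ Pi.single i 1) ⬝ᵥ (U *ᵥ Pi.single j (1:ℝ)) = if i = j then 1 else 0 := by
      intro i j
      have := diag_entry 1 U i j
      rw [mul_one, hU, Matrix.one_mulVec] at this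
      rw [← this, Matrix.one_apply]
    have hsym : ∀ i j, (Uᵀ * H * U) j i = (Uᵀ * H * U) i j := by
      have : (Uᵀ * H * U)ᵀ = Uᵀ * H * U := by
        simp only [Matrix.transpose_mul, Matrix.transpose_transpose, hHs.eq, mul_assoc]
      intro i j
      exact congrFun (congrFun this i) j
    set c := mip Y H with hc
    have hdiag : ∀ j, lamVec X j = lamVec X 0 → (Uᵀ * H * U) j j ≤ c := by
      intro j hj
      have h1 := dirDeriv_ge hX hHs (heig j hj)
      rw [hHd, ← diag_entry, hon] at h1
      simpa using h1
    have hdiag2 : ∀ i, lamVec Y i ≠ 0 → (Uᵀ * H * U) i i = c := by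
      have h1 : ∑ i, lamVec Y i * (c - (Uᵀ * H * U) i i) = 0 := by
        simp only [mul_sub, Finset.sum_sub_distrib]
        rw [← mip_diag hY hUY.2, ← Finset.sum_mul, hsum, ← hc]; ring
      rw [Finset.sum_eq_zero_iff_of_nonneg] at h1
      · intro i hi
        rcases mul_eq_zero.mp (h1 i (Finset.mem_univ i)) with h2 | h2
        · exact absurd h2 hi
        · linarith
      · intro i _
        by_cases hi : lamVec Y i = 0
        · simp [hi]
        · exact mul_nonneg (hw i) (by linarith [hdiag i (hv i hi)])
    intro i j hi hj
    by_cases hij : i = j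
    · subst hij; simp [hdiag2 i hi]
    · rw [if_neg hij]
      have key : ∀ s : ℝ, 2 * s * (Uᵀ * H * U) i j ≤ s ^ 2 * (c - (Uᵀ * H * U) j j) := by
        intro s
        have h1 := dirDeriv_ge (q := U *ᵥ Pi.single i 1 + s • (U *ᵥ Pi.single j 1)) hX hHs (by
          rw [Matrix.mulVec_add, Matrix.mulVec_smul, heig i (hv i hi), heig j hj, smul_add,
            smul_comm s])
        rw [hHd] at h1
        simp only [Matrix.mulVec_add, Matrix.mulVec_smul, dotProduct_add, add_dotProduct,
          smul_dotProduct, dotProduct_smul, smul_eq_mul] at h1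
        rw [← diag_entry, ← diag_entry, ← diag_entry, ← diag_entry, hon, hon, hon, hon,
          if_neg hij, if_neg (Ne.symm hij), hdiag2 i hi, hsym i j] at h1
        simp at h1
        linarith
      set e := (Uᵀ * H * U) i j
      set k := c - (Uᵀ * H * U) j j
      have hk : 0 ≤ k := by have := hdiag j hj; simp only [k]; linarith
      have h2 := key (e / (k + 1))
      have h3 : 2 * (e / (k + 1)) * e = 2 * e ^ 2 / (k + 1) := by ring
      have h4 : (e / (k + 1)) ^ 2 * k ≤ e ^ 2 / (k + 1) := by
        rw [div_pow, div_mul_eq_mul_div, div_le_div_iff₀ (by positivity) (by positivity)]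
        nlinarith [mul_nonneg (sq_nonneg e) hk, sq_nonneg e]
      rw [h3] at h2
      have h5 : 2 * e ^ 2 / (k + 1) ≤ e ^ 2 / (k + 1) := h2.trans h4
      rw [div_le_div_iff_of_pos_right (by positivity)] at h5
      nlinarith
  exact hle hH

lemma quad_bound {n : ℕ} (M : Matrix (Fin n) (Fin n) ℝ) (x y : Fin n → ℝ) :
    |x ⬝ᵥ M *ᵥ y| ≤ (∑ i, ∑ j, |M i j|) * (x ⬝ᵥ x + y ⬝ᵥ y) := by
  have hx : ∀ i, x i ^ 2 ≤ x ⬝ᵥ x := fun i => by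
    rw [sq]; exact Finset.single_le_sum (f := fun i => x i * x i)
      (fun i _ => mul_self_nonneg (x i)) (Finset.mem_univ i)
  have hy : ∀ i, y i ^ 2 ≤ y ⬝ᵥ y := fun i => by
    rw [sq]; exact Finset.single_le_sum (f := fun i => y i * y i)
      (fun i _ => mul_self_nonneg (y i)) (Finset.mem_univ i)
  have h1 : x ⬝ᵥ M *ᵥ y = ∑ i, ∑ j, x i * (M i j * y j) := by
    simp only [dotProduct, Matrix.mulVec, Finset.mul_sum]
  rw [h1, Finset.sum_mul]
  refine (Finset.abs_sum_le_sum_abs _ _).trans (Finset.sum_le_sum fun i _ => ?_)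
  rw [Finset.sum_mul]
  refine (Finset.abs_sum_le_sum_abs _ _).trans (Finset.sum_le_sum fun j _ => ?_)
  rw [abs_mul, abs_mul]
  have h2 : |x i| * |y j| ≤ x ⬝ᵥ x + y ⬝ᵥ y := by
    nlinarith [hx i, hy j, sq_nonneg (|x i| - |y j|), sq_abs (x i), sq_abs (y j),
      abs_nonneg (x i), abs_nonneg (y j)]
  calc |x i| * (|M i j| * |y j|) = |M i j| * (|x i| * |y j|) := by ring
    _ ≤ _ := mul_le_mul_of_nonneg_left h2 (abs_nonneg _)

lemma masked_quad {n : ℕ} (α : Fin n → Prop) (M : Matrix (Fin n) (Fin n) ℝ) (c : ℝ)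
    (hM : ∀ i j, α i → α j → M i j = if i = j then c else 0) (a : Fin n → ℝ)
    (ha : ∀ i, ¬ α i → a i = 0) : a ⬝ᵥ M *ᵥ a = c * (a ⬝ᵥ a) := by
  have h1 : a ⬝ᵥ M *ᵥ a = ∑ i, ∑ j, a i * (M i j * a j) := by
    simp only [dotProduct, Matrix.mulVec, Finset.mul_sum]
  rw [h1, dotProduct, Finset.mul_sum]
  apply Finset.sum_congr rfl
  intro i _
  rw [Finset.sum_eq_single i]
  · by_cases hi : α i
    · rw [hM i i hi hi]; simp; ring
    · simp [ha i hi]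
  · intro j _ hji
    by_cases hi : α i
    · by_cases hj : α j
      · rw [hM i j hi hj, if_neg (Ne.symm hji)]; simp
      · simp [ha j hj]
    · simp [ha i hi]
  · simp

lemma self_dot_nonneg {n : ℕ} (x : Fin n → ℝ) : 0 ≤ x ⬝ᵥ x :=
  Finset.sum_nonneg (fun i _ => mul_self_nonneg (x i))

lemma scalar_aux {t A B E Q P P' ha1 hb1 kab kbb kaa rr CH CK CR μ c δ ε : ℝ}
    (ht0 : 0 < t) (ht1 : t ≤ 1) (hCH0 : 0 ≤ CH) (hCK0 : 0 ≤ CK) (hCR0 : 0 ≤ CR) (hε : 0 ≤ ε)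
    (ht2 : t * (2 * (2 * CH + 2 * CK + |μ| + |c|)) ≤ δ)
    (ht3 : t * (4 * (2 * CH + 2 * CK + |μ| + |c|) * CR + CK) ≤ ε)
    (hA0 : 0 ≤ A) (hB0 : 0 ≤ B) (hE0 : 0 ≤ E)
    (hN : kaa + 2 * Q = c * A) (hsq : -P' + 2 * t * ha1 = -P + t ^ 2 * Q) (hDe : δ * E ≤ P)
    (hRR : rr ≤ 2 * CR * A) (hBE : B ≤ 2 * E + 2 * t ^ 2 * rr)
    (b1 : hb1 ≤ 2 * CH * B) (b2 : kbb ≤ 2 * CK * B) (b3 : t * kab ≤ CK * (t ^ 2 * A + B)) :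
    -P' + t * (μ * A + 2 * ha1 + hb1) + t ^ 2 / 2 * (kaa + 2 * kab + kbb) ≤
      (t * μ + t ^ 2 / 2 * c + ε * t ^ 2) * (A + B) := by
  set C := 2 * CH + 2 * CK + |μ| + |c| with hC
  have hC0 : 0 ≤ C := by positivity
  have hBE2 : B ≤ 2 * E + 4 * t ^ 2 * CR * A := by
    have := mul_le_mul_of_nonneg_left hRR (by positivity : 0 ≤ 2 * t ^ 2)
    have e : 2 * t ^ 2 * (2 * CR * A) = 4 * t ^ 2 * CR * A := by ring
    linarith
  have s1 : t * hb1 + t ^ 2 * kab + t ^ 2 / 2 * kbb ≤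
      t * (2 * CH + 2 * CK) * B + t ^ 3 * CK * A := by
    have i1 := mul_le_mul_of_nonneg_left b1 ht0.le
    have i2 := mul_le_mul_of_nonneg_left b3 ht0.le
    have i3 := mul_le_mul_of_nonneg_left b2 (by positivity : 0 ≤ t ^ 2 / 2)
    have i4 : t ^ 2 * (CK * B) ≤ t * (CK * B) := by
      apply mul_le_mul_of_nonneg_right _ (by positivity); nlinarith
    have e1 : t * (t * kab) = t ^ 2 * kab := by ring
    have e2 : t * (CK * (t ^ 2 * A + B)) = t ^ 3 * CK * A + t * (CK * B) := by ring
    have e3 : t ^ 2 / 2 * (2 * CK * B) = t ^ 2 * (CK * B) := by ring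
    have e4 : t * (2 * CH * B) + (t * (CK * B) + t * (CK * B)) = t * (2 * CH + 2 * CK) * B := by
      ring
    linarith
  have s2 : -(t * μ + t ^ 2 / 2 * c) * B ≤ t * (|μ| + |c|) * B := by
    apply mul_le_mul_of_nonneg_right _ hB0
    have i1 : -μ ≤ |μ| := neg_le_abs μ
    have i2 : -c ≤ |c| := neg_le_abs c
    have i3 : t ^ 2 / 2 * |c| ≤ t * |c| := by
      apply mul_le_mul_of_nonneg_right _ (abs_nonneg c); nlinarith
    have i4 := mul_le_mul_of_nonneg_left i1 ht0.le
    have i5 := mul_le_mul_of_nonneg_left i2 (by positivity : 0 ≤ t ^ 2 / 2)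
    linarith
  have s3 : t * C * B ≤ t * C * (2 * E + 4 * t ^ 2 * CR * A) :=
    mul_le_mul_of_nonneg_left hBE2 (by positivity)
  have s4 : t * (2 * C) * E ≤ δ * E := mul_le_mul_of_nonneg_right ht2 hE0
  have s5 : t * (4 * C * CR + CK) * (t ^ 2 * A) ≤ ε * (t ^ 2 * A) :=
    mul_le_mul_of_nonneg_right ht3 (by positivity)
  have s6 : 0 ≤ ε * t ^ 2 * B := by positivity
  have s7 : t * C * B = t * (2 * CH + 2 * CK) * B + t * (|μ| + |c|) * B := by rw [hC]; ring
  have hN3 : t ^ 2 / 2 * kaa = t ^ 2 / 2 * c * A - t ^ 2 * Q := by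
    rw [mul_assoc, ← hN]; ring
  have e1 : t * C * (2 * E + 4 * t ^ 2 * CR * A) + t ^ 3 * CK * A =
    t * (2 * C) * E + t * (4 * C * CR + CK) * (t ^ 2 * A) := by ring
  have e2 : -P' + t * (μ * A + 2 * ha1 + hb1) + t ^ 2 / 2 * (kaa + 2 * kab + kbb) =
    (-P' + 2 * t * ha1) + t * μ * A + t ^ 2 / 2 * kaa +
      (t * hb1 + t ^ 2 * kab + t ^ 2 / 2 * kbb) := by ring
  have e3 : (t * μ + t ^ 2 / 2 * c + ε * t ^ 2) * (A + B) = t * μ * A + t ^ 2 / 2 * c * A +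
    ε * (t ^ 2 * A) + ε * t ^ 2 * B - (-(t * μ + t ^ 2 / 2 * c) * B) := by ring
  rw [e2, e3]
  linarith

/-- second order upper estimate of the largest eigenvalue in coordinates -/
lemma second_order_upper {n : ℕ} (D : Fin n → ℝ) (α : Fin n → Prop) (δ : ℝ) (hδ : 0 < δ)
    (hD0 : ∀ i, α i → D i = 0) (hD : ∀ i, ¬ α i → δ ≤ D i)
    (H K : Matrix (Fin n) (Fin n) ℝ) (hHs : H.IsSymm) (hKs : K.IsSymm) (μ c : ℝ)
    (hH : ∀ i j, α i → α j → H i j = if i = j then μ else 0)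
    (hK : ∀ i j, α i → α j →
      (K + (2 : ℝ) • (H * Matrix.diagonal (fun l => (D l)⁻¹) * H)) i j = if i = j then c else 0)
    (ε : ℝ) (hε : 0 < ε) :
    ∀ᶠ t : ℝ in 𝓝[>] 0, ∀ z : Fin n → ℝ,
      - (∑ i, D i * z i ^ 2) + t * (z ⬝ᵥ H *ᵥ z) + t ^ 2 / 2 * (z ⬝ᵥ K *ᵥ z) ≤
        (t * μ + t ^ 2 / 2 * c + ε * t ^ 2) * (z ⬝ᵥ z) := by
  set R : Matrix (Fin n) (Fin n) ℝ := Matrix.diagonal (fun l => (D l)⁻¹) * H with hR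
  set CH := ∑ i, ∑ j, |H i j| with hCH
  set CK := ∑ i, ∑ j, |K i j| with hCK
  set CR := ∑ i, ∑ j, |(Rᵀ * R) i j| with hCR
  have hCH0 : 0 ≤ CH := Finset.sum_nonneg fun i _ => Finset.sum_nonneg fun j _ => abs_nonneg _
  have hCK0 : 0 ≤ CK := Finset.sum_nonneg fun i _ => Finset.sum_nonneg fun j _ => abs_nonneg _
  have hCR0 : 0 ≤ CR := Finset.sum_nonneg fun i _ => Finset.sum_nonneg fun j _ => abs_nonneg _
  set C := 2 * CH + 2 * CK + |μ| + |c| with hC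
  have hC0 : 0 ≤ C := by positivity
  have ev : ∀ (k m : ℝ), 0 < m → ∀ᶠ t : ℝ in 𝓝[>] 0, t * k ≤ m := by
    intro k m hm
    have h1 : Tendsto (fun t : ℝ => t * k) (𝓝[>] 0) (𝓝 (0 * k)) :=
      ((continuous_id.mul continuous_const).tendsto 0).mono_left nhdsWithin_le_nhds
    rw [zero_mul] at h1
    exact (h1.eventually_lt_const hm).mono fun t ht => ht.le
  filter_upwards [self_mem_nhdsWithin, ev 1 1 one_pos, ev (2 * C) δ hδ,
    ev (4 * C * CR + CK) ε hε] with t ht0 ht1 ht2 ht3 z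
  have ht0 : 0 < t := ht0
  rw [mul_one] at ht1
  set a : Fin n → ℝ := fun i => if α i then z i else 0 with ha
  set b : Fin n → ℝ := fun i => if α i then 0 else z i with hb
  have hz : z = a + b := by
    funext i; simp only [ha, hb, Pi.add_apply]; split_ifs <;> simp
  have ha0 : ∀ i, ¬ α i → a i = 0 := fun i hi => by simp [ha, hi]
  have hb0 : ∀ i, α i → b i = 0 := fun i hi => by simp [hb, hi]
  have hab : a ⬝ᵥ b = 0 := by
    apply Finset.sum_eq_zero; intro i _
    by_cases hi : α i
    · rw [hb0 i hi, mul_zero]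
    · rw [ha0 i hi, zero_mul]
  set e : Fin n → ℝ := b - t • (R *ᵥ a) with he
  have hRi : ∀ i, (R *ᵥ a) i = (D i)⁻¹ * (H *ᵥ a) i := by
    intro i
    rw [hR, ← Matrix.mulVec_mulVec, Matrix.mulVec_diagonal]
  have sym : ∀ (M : Matrix (Fin n) (Fin n) ℝ), M.IsSymm → ∀ x y : Fin n → ℝ,
      x ⬝ᵥ M *ᵥ y = y ⬝ᵥ M *ᵥ x := by
    intro M hM x y
    rw [Matrix.dotProduct_mulVec, ← Matrix.mulVec_transpose, hM, dotProduct_comm]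
  have hzH : z ⬝ᵥ H *ᵥ z = μ * (a ⬝ᵥ a) + 2 * (b ⬝ᵥ H *ᵥ a) + b ⬝ᵥ H *ᵥ b := by
    rw [hz, Matrix.mulVec_add, dotProduct_add, add_dotProduct, add_dotProduct,
      masked_quad α H μ hH a ha0, sym H hHs a b]
    ring
  have hzK : z ⬝ᵥ K *ᵥ z = a ⬝ᵥ K *ᵥ a + 2 * (a ⬝ᵥ K *ᵥ b) + b ⬝ᵥ K *ᵥ b := by
    rw [hz, Matrix.mulVec_add, dotProduct_add, add_dotProduct, add_dotProduct, sym K hKs b a]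
    ring
  have hzz : z ⬝ᵥ z = a ⬝ᵥ a + b ⬝ᵥ b := by
    rw [hz, dotProduct_add, add_dotProduct, add_dotProduct, dotProduct_comm b a, hab]; ring
  have hN := masked_quad α _ c hK a ha0
  have hN2 : a ⬝ᵥ (H * Matrix.diagonal (fun l => (D l)⁻¹) * H) *ᵥ a =
      ∑ i, (D i)⁻¹ * (H *ᵥ a) i ^ 2 := by
    have h1 := quad_conj H (Matrix.diagonal (fun l => (D l)⁻¹)) a
    rw [hHs, quad_diag] at h1
    exact h1
  rw [Matrix.add_mulVec, dotProduct_add, Matrix.smul_mulVec, dotProduct_smul, smul_eq_mul,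
    hN2] at hN
  have hsq : - (∑ i, D i * z i ^ 2) + 2 * t * (b ⬝ᵥ H *ᵥ a) =
      - (∑ i, D i * e i ^ 2) + t ^ 2 * ∑ i, (D i)⁻¹ * (H *ᵥ a) i ^ 2 := by
    rw [dotProduct, Finset.mul_sum, Finset.mul_sum, ← Finset.sum_neg_distrib,
      ← Finset.sum_neg_distrib, ← Finset.sum_add_distrib, ← Finset.sum_add_distrib]
    apply Finset.sum_congr rfl
    intro i _
    simp only [he, Pi.sub_apply, Pi.smul_apply, smul_eq_mul, hRi]
    by_cases hi : α i
    · simp [hD0 i hi, hb0 i hi]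
    · have hDi : D i ≠ 0 := by linarith [hD i hi] |> fun h : 0 < D i => h.ne'
      have hzi : z i = b i := by simp [hb, hi]
      rw [hzi]
      field_simp
      ring
  have hDe : δ * (e ⬝ᵥ e) ≤ ∑ i, D i * e i ^ 2 := by
    rw [dotProduct, Finset.mul_sum]
    apply Finset.sum_le_sum
    intro i _
    by_cases hi : α i
    · have : e i = 0 := by simp [he, hRi, hb0 i hi, hD0 i hi]
      simp [this]
    · rw [← sq]; exact mul_le_mul_of_nonneg_right (hD i hi) (sq_nonneg _)
  have hRR : (R *ᵥ a) ⬝ᵥ (R *ᵥ a) ≤ 2 * CR * (a ⬝ᵥ a) := by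
    have h1 : (R *ᵥ a) ⬝ᵥ (R *ᵥ a) = a ⬝ᵥ (Rᵀ * R) *ᵥ a := by
      rw [← Matrix.mulVec_mulVec a Rᵀ R, Matrix.dotProduct_mulVec a, Matrix.vecMul_transpose]
    rw [h1]
    have := (le_abs_self _).trans (quad_bound (Rᵀ * R) a a)
    rw [← hCR] at this
    linarith
  have hBE : b ⬝ᵥ b ≤ 2 * (e ⬝ᵥ e) + 2 * t ^ 2 * ((R *ᵥ a) ⬝ᵥ (R *ᵥ a)) := by
    simp only [dotProduct]
    rw [Finset.mul_sum, Finset.mul_sum, ← Finset.sum_add_distrib]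
    apply Finset.sum_le_sum
    intro i _
    simp only [he, Pi.sub_apply, Pi.smul_apply, smul_eq_mul]
    nlinarith [sq_nonneg (b i - 2 * (t * (R *ᵥ a) i))]
  have b1 : b ⬝ᵥ H *ᵥ b ≤ 2 * CH * (b ⬝ᵥ b) := by
    have := (le_abs_self _).trans (quad_bound H b b)
    rw [← hCH] at this; linarith
  have b2 : b ⬝ᵥ K *ᵥ b ≤ 2 * CK * (b ⬝ᵥ b) := by
    have := (le_abs_self _).trans (quad_bound K b b)
    rw [← hCK] at this; linarith
  have b3 : t * (a ⬝ᵥ K *ᵥ b) ≤ CK * (t ^ 2 * (a ⬝ᵥ a) + b ⬝ᵥ b) := by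
    have := (le_abs_self _).trans (quad_bound K (t • a) b)
    rw [← hCK] at this
    simp only [smul_dotProduct, dotProduct_smul, smul_eq_mul] at this
    calc _ ≤ _ := this
      _ = _ := by ring
  have hA0 := self_dot_nonneg a
  have hB0 := self_dot_nonneg b
  have hE0 := self_dot_nonneg e
  rw [hzH, hzK, hzz]
  exact scalar_aux ht0 ht1 hCH0 hCK0 hCR0 hε.le ht2 ht3 hA0 hB0 hE0 hN hsq hDe hRR hBE b1 b2 b3

lemma taylor_one {E : Type*} [NormedAddCommGroup E] [NormedSpace ℝ E] {φ φ' : ℝ → E} {k : E}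
    (h1 : ∀ t, HasDerivAt φ (φ' t) t) (h2 : HasDerivAt φ' k 0) (ε : ℝ) (hε : 0 < ε) :
    ∀ᶠ t : ℝ in 𝓝 0, ‖φ t - φ 0 - t • φ' 0 - (t ^ 2 / 2) • k‖ ≤ ε * t ^ 2 := by
  have h3 := (hasDerivAt_iff_isLittleO.mp h2).def hε
  rw [Metric.eventually_nhds_iff] at h3 ⊢
  obtain ⟨r, hr, h3⟩ := h3
  refine ⟨r, hr, fun t ht => ?_⟩
  set ψ : ℝ → E := fun s => φ s - φ 0 - s • φ' 0 - (s ^ 2 / 2) • k with hψ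
  have hd : ∀ s, HasDerivAt ψ (φ' s - φ' 0 - s • k) s := by
    intro s
    have a1 : HasDerivAt (fun s : ℝ => s • φ' 0) ((1 : ℝ) • φ' 0) s :=
      (hasDerivAt_id s).smul_const _
    have a2 : HasDerivAt (fun s : ℝ => (s ^ 2 / 2) • k) (s • k) s := by
      have : HasDerivAt (fun s : ℝ => s ^ 2 / 2) s s := by
        have := (hasDerivAt_pow 2 s).div_const 2
        simpa using this
      exact this.smul_const k
    have := (((h1 s).sub_const (φ 0)).sub a1).sub a2
    rw [one_smul] at this
    exact this
  have hm : ∀ s ∈ Metric.closedBall (0 : ℝ) |t|, ‖φ' s - φ' 0 - s • k‖ ≤ ε * |t| := by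
    intro s hs
    have hs' : |s| ≤ |t| := by simpa using hs
    have h4 := h3 (y := s) (by
      rw [Real.dist_eq, sub_zero] at ht ⊢
      exact lt_of_le_of_lt hs' ht)
    simp only [sub_zero, Real.norm_eq_abs] at h4
    exact h4.trans (mul_le_mul_of_nonneg_left hs' hε.le)
  have := (convex_closedBall (0 : ℝ) |t|).norm_image_sub_le_of_norm_hasDerivWithin_le
    (f := ψ) (fun s _ => (hd s).hasDerivWithinAt) hm (x := 0) (y := t) (by simp) (by simp)
  have h0 : ψ 0 = 0 := by simp [hψ]
  rw [h0, sub_zero, sub_zero, Real.norm_eq_abs] at this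
  calc _ ≤ _ := this
    _ = ε * (|t| * |t|) := by ring
    _ = _ := by rw [abs_mul_abs_self, sq]

lemma near_curve {EX : Type*} [NormedAddCommGroup EX] [NormedSpace ℝ EX] (xb d w : EX)
    (η : ℝ) {s : Set EX} (hs : s ∈ 𝓝 xb) :
    ∀ᶠ t : ℝ in 𝓝 0, ∀ x, ‖x - (xb + t • d + (t ^ 2 / 2) • w)‖ ≤ η * t ^ 2 → x ∈ s := by
  obtain ⟨r, hr, hrs⟩ := Metric.mem_nhds_iff.mp hs
  have h1 : Tendsto (fun t : ℝ => η * t ^ 2 + ‖t • d + (t ^ 2 / 2) • w‖) (𝓝 0) (𝓝 0) := by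
    have : Continuous (fun t : ℝ => η * t ^ 2 + ‖t • d + (t ^ 2 / 2) • w‖) := by fun_prop
    simpa using this.tendsto 0
  filter_upwards [h1.eventually_lt_const hr] with t ht x hx
  apply hrs
  rw [Metric.mem_ball, dist_eq_norm]
  have : x - xb = (x - (xb + t • d + (t ^ 2 / 2) • w)) + (t • d + (t ^ 2 / 2) • w) := by abel
  rw [this]
  exact (norm_add_le _ _).trans_lt (by linarith)

/-- second order directional derivative -/
def sec {EX E : Type*} [NormedAddCommGroup EX] [NormedSpace ℝ EX]
    [NormedAddCommGroup E] [NormedSpace ℝ E] (F : EX → E) (xb d : EX) : E :=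
  fderiv ℝ (fun x' => fderiv ℝ F x' d) xb d

lemma taylor_curve {EX E : Type*} [NormedAddCommGroup EX] [NormedSpace ℝ EX]
    [NormedAddCommGroup E] [NormedSpace ℝ E] {F : EX → E} (hF : ContDiff ℝ 2 F) (xb d w : EX)
    (ε : ℝ) (hε : 0 < ε) : ∀ᶠ t : ℝ in 𝓝 0,
      ‖F (xb + t • d + (t ^ 2 / 2) • w) - F xb - t • fderiv ℝ F xb d
        - (t ^ 2 / 2) • (sec F xb d + fderiv ℝ F xb w)‖ ≤ ε * t ^ 2 := by
  have hFd : Differentiable ℝ F := hF.differentiable (by norm_num)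
  have hF' : ContDiff ℝ 1 (fderiv ℝ F) := hF.fderiv_right (by norm_num)
  have hFd' : Differentiable ℝ (fderiv ℝ F) := hF'.differentiable (by norm_num)
  set p : ℝ → EX := fun t => xb + t • d + (t ^ 2 / 2) • w with hp
  have hpd : ∀ t, HasDerivAt p (d + t • w) t := by
    intro s
    have a1 : HasDerivAt (fun s : ℝ => s • d) ((1 : ℝ) • d) s :=
      (hasDerivAt_id s).smul_const _
    have a2 : HasDerivAt (fun s : ℝ => (s ^ 2 / 2) • w) (s • w) s := by
      have : HasDerivAt (fun s : ℝ => s ^ 2 / 2) s s := by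
        have := (hasDerivAt_pow 2 s).div_const 2
        simpa using this
      exact this.smul_const w
    have := (a1.const_add xb).add a2
    rw [one_smul] at this
    exact this
  have hp0 : p 0 = xb := by simp [hp]
  have h1 : ∀ t, HasDerivAt (fun t => F (p t)) (fderiv ℝ F (p t) (d + t • w)) t :=
    fun t => (hFd (p t)).hasFDerivAt.comp_hasDerivAt t (hpd t)
  have hsec : sec F xb d = fderiv ℝ (fderiv ℝ F) xb d d := by
    unfold sec
    have := ((hFd' xb).hasFDerivAt.clm_apply (hasFDerivAt_const d xb)).fderiv
    rw [this]; simp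
  have h2 : HasDerivAt (fun t => fderiv ℝ F (p t) (d + t • w))
      (sec F xb d + fderiv ℝ F xb w) 0 := by
    have a0 : HasFDerivAt (fderiv ℝ F) (fderiv ℝ (fderiv ℝ F) (p 0)) (p 0) :=
      (hFd' (p 0)).hasFDerivAt
    have a1 := a0.comp_hasDerivAt (0 : ℝ) (hpd 0)
    have a2 : HasDerivAt (fun s : ℝ => d + s • w) ((1 : ℝ) • w) 0 :=
      ((hasDerivAt_id (0:ℝ)).smul_const w).const_add d
    have a3 := a1.clm_apply a2
    rw [hsec]
    simpa [hp0] using a3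
  have h3 := taylor_one h1 h2 ε hε
  filter_upwards [h3] with t ht
  simpa [hp0] using ht

lemma taylor_near {EX E : Type*} [NormedAddCommGroup EX] [NormedSpace ℝ EX]
    [NormedAddCommGroup E] [NormedSpace ℝ E] {F : EX → E} (hF : ContDiff ℝ 2 F) (xb d w : EX)
    (ε : ℝ) (hε : 0 < ε) : ∃ η₀ > 0, ∀ η, 0 < η → η ≤ η₀ → ∀ᶠ t : ℝ in 𝓝 0, 
      ∀ x, ‖x - (xb + t • d + (t ^ 2 / 2) • w)‖ ≤ η * t ^ 2 → 
      ‖F x - F xb - t • fderiv ℝ F xb d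
        - (t ^ 2 / 2) • (sec F xb d + fderiv ℝ F xb w)‖ ≤ ε * t ^ 2 := by
  obtain ⟨K, s, hs, hK⟩ := (hF.of_le (by norm_num : (1 : WithTop ℕ∞) ≤ 2)).contDiffAt
    (x := xb) |>.exists_lipschitzOnWith
  refine ⟨ε / 2 / (K + 1), by positivity, fun η hη hηle => ?_⟩
  filter_upwards [taylor_curve hF xb d w (ε / 2) (by positivity), near_curve xb d w η hs]
    with t h1 h2 x hx
  have hps : xb + t • d + (t ^ 2 / 2) • w ∈ s := h2 _ (by simp; positivity)
  have h3 := hK.norm_sub_le (h2 x hx) hps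
  have h4 : (K : ℝ) * ‖x - (xb + t • d + (t ^ 2 / 2) • w)‖ ≤ ε / 2 * t ^ 2 := by
    have hKη : (K : ℝ) * η ≤ ε / 2 := by
      have : ((K : ℝ) + 1) * η ≤ ε / 2 := by
        rw [mul_comm]; exact (le_div_iff₀ (by positivity)).mp hηle
      linarith
    calc _ ≤ (K : ℝ) * (η * t ^ 2) := mul_le_mul_of_nonneg_left hx K.2
      _ = (K * η) * t ^ 2 := by ring
      _ ≤ _ := mul_le_mul_of_nonneg_right hKη (sq_nonneg t)
  have h5 : F x - F xb - t • fderiv ℝ F xb d - (t ^ 2 / 2) • (sec F xb d + fderiv ℝ F xb w) =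
    (F x - F (xb + t • d + (t ^ 2 / 2) • w)) + (F (xb + t • d + (t ^ 2 / 2) • w) - F xb
      - t • fderiv ℝ F xb d - (t ^ 2 / 2) • (sec F xb d + fderiv ℝ F xb w)) := by abel
  rw [h5]
  refine (norm_add_le _ _).trans ?_
  linarith

lemma feasible_near {EX EY : Type*} [NormedAddCommGroup EX] [NormedSpace ℝ EX] [CompleteSpace EX]
    [NormedAddCommGroup EY] [NormedSpace ℝ EY] [CompleteSpace EY]
    {h : EX → EY} (hh : ContDiff ℝ 2 h) (xb d w : EX)
    (hsurj : Function.Surjective (fderiv ℝ h xb)) (h0 : h xb = 0) (hd : fderiv ℝ h xb d = 0)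
    (hw : sec h xb d + fderiv ℝ h xb w = 0) (η : ℝ) (hη : 0 < η) :
    ∀ᶠ t : ℝ in 𝓝 0, ∃ x, ‖x - (xb + t • d + (t ^ 2 / 2) • w)‖ ≤ η * t ^ 2 ∧ h x = 0 := by
  have hst : HasStrictFDerivAt h (fderiv ℝ h xb) xb :=
    hh.contDiffAt.hasStrictFDerivAt (by norm_num)
  have hr : (fderiv ℝ h xb).range = ⊤ := LinearMap.range_eq_top.mpr hsurj
  set R := (fderiv ℝ h xb).nonlinearRightInverseOfSurjective hr with hRdef
  have hRpos : 0 < R.nnnorm := (fderiv ℝ h xb).nonlinearRightInverseOfSurjective_nnnorm_pos hr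
  have hc : 0 < R.nnnorm⁻¹ / 2 := by positivity
  obtain ⟨s, hs, hA⟩ := hst.approximates_deriv_on_nhds (c := R.nnnorm⁻¹ / 2) (Or.inr hc)
  have hk : 0 < ((R.nnnorm : ℝ)⁻¹ - ((R.nnnorm⁻¹ / 2 : NNReal) : ℝ)) * η := by
    apply mul_pos _ hη
    push_cast
    have : 0 < (R.nnnorm : ℝ)⁻¹ := by positivity
    linarith
  filter_upwards [taylor_curve hh xb d w _ hk, near_curve xb d w η hs] with t h1 h2
  rw [h0, hd, hw] at h1
  simp only [smul_zero, sub_zero] at h1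
  have h3 := hA.surjOn_closedBall_of_nonlinearRightInverse R (ε := η * t ^ 2)
    (b := xb + t • d + (t ^ 2 / 2) • w) (by positivity) (by
      intro x hx
      exact h2 x (by simpa [dist_eq_norm] using hx))
  obtain ⟨x, hx, hx0⟩ := h3 (a := 0) (by
    rw [Metric.mem_closedBall, dist_eq_norm, zero_sub, norm_neg]
    calc _ ≤ _ := h1
      _ = _ := by ring)
  exact ⟨x, by simpa [dist_eq_norm] using hx, hx0⟩

lemma mip_sum {n : ℕ} (A B : Matrix (Fin n) (Fin n) ℝ) : mip A B = ∑ i, ∑ j, A i j * B i j := by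
  unfold mip
  rw [Matrix.trace]
  simp only [Matrix.diag_apply, Matrix.mul_apply, Matrix.transpose_apply]
  rw [Finset.sum_comm]

lemma mip_comm {n : ℕ} (A B : Matrix (Fin n) (Fin n) ℝ) : mip A B = mip B A := by
  simp only [mip_sum, mul_comm]

lemma mip_add {n : ℕ} (A B C : Matrix (Fin n) (Fin n) ℝ) : mip A (B + C) = mip A B + mip A C := by
  simp [mip, mul_add]

lemma mip_smul {n : ℕ} (c : ℝ) (A B : Matrix (Fin n) (Fin n) ℝ) : mip A (c • B) = c * mip A B := by
  simp [mip]

lemma mip_sub {n : ℕ} (A B C : Matrix (Fin n) (Fin n) ℝ) : mip A (B - C) = mip A B - mip A C := by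
  simp [mip, mul_sub]

lemma mip_add_left {n : ℕ} (A B C : Matrix (Fin n) (Fin n) ℝ) :
    mip (A + B) C = mip A C + mip B C := by
  simp [mip, add_mul]

lemma mip_smul_left {n : ℕ} (c : ℝ) (A B : Matrix (Fin n) (Fin n) ℝ) :
    mip (c • A) B = c * mip A B := by
  simp [mip]

/-- the inner product with a fixed matrix as a continuous linear map -/
def mipC {n : ℕ} (Y : Matrix (Fin n) (Fin n) ℝ) : Matrix (Fin n) (Fin n) ℝ →L[ℝ] ℝ :=
  LinearMap.toContinuousLinearMap
    { toFun := fun A => mip Y A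
      map_add' := fun A B => mip_add Y A B
      map_smul' := fun c A => by simpa using mip_smul c Y A }

lemma mipC_apply {n : ℕ} (Y A : Matrix (Fin n) (Fin n) ℝ) : mipC Y A = mip Y A := rfl

lemma psd_trace_bound {n : ℕ} {Y : Matrix (Fin n) (Fin n) ℝ} (hY : Y.IsSymm)
    (hp : ∀ z : Fin n → ℝ, 0 ≤ z ⬝ᵥ Y *ᵥ z) (htr : Y.trace = 1) (i j : Fin n) : |Y i j| ≤ 1 := by
  have hd : ∀ k, 0 ≤ Y k k := fun k => by simpa using hp (Pi.single k 1)
  have hd1 : ∀ k, Y k k ≤ 1 := fun k => by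
    rw [← htr]
    exact Finset.single_le_sum (f := fun k => Y k k) (fun k _ => hd k) (Finset.mem_univ k)
  have hs : Y j i = Y i j := hY.apply i j
  have h1 := hp (Pi.single i 1 + Pi.single j 1)
  have h2 := hp (Pi.single i 1 - Pi.single j 1)
  simp only [Matrix.mulVec_add, Matrix.mulVec_sub, add_dotProduct, sub_dotProduct, dotProduct_add,
    dotProduct_sub] at h1 h2
  simp at h1 h2
  rw [abs_le]
  constructor <;> linarith [hd1 i, hd1 j]

/-- reduced multiplier set -/
def MulSet {n : ℕ} [NeZero n] {EX EY : Type*} [AddCommGroup EX] [Module ℝ EX] [AddCommGroup EY]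
    [Module ℝ EY] (φ : EX →ₗ[ℝ] ℝ) (G : EX →ₗ[ℝ] Matrix (Fin n) (Fin n) ℝ) (A : EX →ₗ[ℝ] EY)
    (X : Matrix (Fin n) (Fin n) ℝ) : Set (Matrix (Fin n) (Fin n) ℝ) :=
  {Y | Y ∈ msubdiff (fun X => lamVec X 0) X ∧ ∀ d, A d = 0 → φ d + mip Y (G d) = 0}

lemma MulSet_extreme {n : ℕ} [NeZero n] {EX EY : Type*} [AddCommGroup EX] [Module ℝ EX]
    [AddCommGroup EY]
    [Module ℝ EY] (φ : EX →ₗ[ℝ] ℝ) (G : EX →ₗ[ℝ] Matrix (Fin n) (Fin n) ℝ) (A : EX →ₗ[ℝ] EY)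
    (X : Matrix (Fin n) (Fin n) ℝ) (hX : X.IsSymm) (hne : (MulSet φ G A X).Nonempty) :
    ∃ Y, Y ∈ (MulSet φ G A X).extremePoints ℝ := by
  have hc : ∀ B : Matrix (Fin n) (Fin n) ℝ, Continuous (fun Y => mip Y B) := fun B => by
    have : (fun Y => mip Y B) = mipC B := by
      funext Y; rw [mipC_apply, mip_comm]
    rw [this]; exact (mipC B).continuous
  have hcl : IsClosed (MulSet φ G A X) := by
    have : MulSet φ G A X = ({Y | Yᵀ = Y} ∩ ⋂ Z : Matrix (Fin n) (Fin n) ℝ, ⋂ _ : Z.IsSymm,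
        {Y | lamVec X 0 + mip Y (Z - X) ≤ lamVec Z 0}) ∩ ⋂ d, ⋂ _ : A d = 0,
          {Y | φ d + mip Y (G d) = 0} := by
      ext Y
      simp [MulSet, msubdiff, Matrix.IsSymm]
    rw [this]
    refine ((isClosed_eq (by fun_prop) continuous_id).inter ?_).inter ?_
    · exact isClosed_iInter fun Z => isClosed_iInter fun _ =>
        isClosed_le (continuous_const.add (hc _)) continuous_const
    · exact isClosed_iInter fun Z => isClosed_iInter fun _ =>
        isClosed_eq (continuous_const.add (hc _)) continuous_const
  have hb : MulSet φ G A X ⊆ Metric.closedBall 0 1 := by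
    intro Y hY
    obtain ⟨h1, h2, h3, h4⟩ := msub_forward hX hY.1
    rw [mem_closedBall_zero_iff, Matrix.norm_le_iff zero_le_one]
    intro i j
    exact psd_trace_bound h1 h2 h3 i j
  have hcomp : IsCompact (MulSet φ G A X) := (isCompact_closedBall 0 1).of_isClosed_subset hcl hb
  haveI : LocallyConvexSpace ℝ (Matrix (Fin n) (Fin n) ℝ) :=
    inferInstanceAs (LocallyConvexSpace ℝ (Fin n → Fin n → ℝ))
  exact hcomp.extremePoints_nonempty hne

lemma trace_conj {n : ℕ} {U : Matrix (Fin n) (Fin n) ℝ} (hU : Uᵀ * U = 1)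
    (Z : Matrix (Fin n) (Fin n) ℝ) : (U * Z * Uᵀ).trace = Z.trace := by
  rw [Matrix.trace_mul_comm, ← mul_assoc, hU, one_mul]

lemma mip_conj {n : ℕ} (U Z B : Matrix (Fin n) (Fin n) ℝ) :
    mip (U * Z * Uᵀ) B = mip Z (Uᵀ * B * U) := by
  unfold mip
  rw [Matrix.transpose_mul, Matrix.transpose_mul, Matrix.transpose_transpose]
  rw [show U * (Zᵀ * Uᵀ) * B = U * (Zᵀ * (Uᵀ * B)) by simp only [mul_assoc], Matrix.trace_mul_comm]
  simp only [mul_assoc]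

lemma conj_symm {n : ℕ} {A : Matrix (Fin n) (Fin n) ℝ} (hA : A.IsSymm)
    (U : Matrix (Fin n) (Fin n) ℝ) : (Uᵀ * A * U).IsSymm := by
  unfold Matrix.IsSymm
  simp [Matrix.transpose_mul, hA.eq, mul_assoc]

lemma conj_symm' {n : ℕ} {A : Matrix (Fin n) (Fin n) ℝ} (hA : A.IsSymm)
    (U : Matrix (Fin n) (Fin n) ℝ) : (U * A * Uᵀ).IsSymm := by
  unfold Matrix.IsSymm
  simp [Matrix.transpose_mul, hA.eq, mul_assoc]

lemma exists_pos_lb {n : ℕ} (α : Fin n → Prop) (w : Fin n → ℝ) (h : ∀ i, α i → 0 < w i) :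
    ∃ m > 0, ∀ i, α i → m ≤ w i := by
  rcases (Finset.univ.filter α).eq_empty_or_nonempty with he | hne
  · refine ⟨1, one_pos, fun i hi => ?_⟩
    have : i ∈ Finset.univ.filter α := by simp [hi]
    rw [he] at this; simp at this
  · obtain ⟨i, hi, hmin⟩ := Finset.exists_min_image _ w hne
    refine ⟨w i, h i (by simpa using hi), fun j hj => hmin j (by simp [hj])⟩

lemma pert_psd {n : ℕ} (α : Fin n → Prop) (w : Fin n → ℝ) (h : ∀ i, α i → 0 < w i)
    (hw : ∀ i, 0 ≤ w i)
    (Z : Matrix (Fin n) (Fin n) ℝ) (hZ : ∀ i j, ¬ (α i ∧ α j) → Z i j = 0) :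
    ∃ t > 0, ∀ s : ℝ, |s| ≤ t → ∀ z : Fin n → ℝ, 0 ≤ z ⬝ᵥ (Matrix.diagonal w + s • Z) *ᵥ z := by
  obtain ⟨m, hm, hmw⟩ := exists_pos_lb α w h
  set C := ∑ i, ∑ j, |Z i j| with hC
  have hC0 : 0 ≤ C := Finset.sum_nonneg fun i _ => Finset.sum_nonneg fun j _ => abs_nonneg _
  refine ⟨m / (2 * C + 1), by positivity, fun s hs z => ?_⟩
  set a : Fin n → ℝ := fun i => if α i then z i else 0 with ha
  have h1 : z ⬝ᵥ Z *ᵥ z = a ⬝ᵥ Z *ᵥ a := by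
    simp only [dotProduct, Matrix.mulVec, Finset.mul_sum]
    refine Finset.sum_congr rfl fun i _ => Finset.sum_congr rfl fun j _ => ?_
    by_cases hij : α i ∧ α j
    · simp [ha, hij.1, hij.2]
    · simp [hZ i j hij]
  have h2 := quad_bound Z a a
  have h3 : m * (a ⬝ᵥ a) ≤ ∑ i, w i * z i ^ 2 := by
    simp only [dotProduct, Finset.mul_sum]
    refine Finset.sum_le_sum fun i _ => ?_
    by_cases hi : α i
    · simp only [ha, hi, if_true]
      nlinarith [mul_le_mul_of_nonneg_right (hmw i hi) (sq_nonneg (z i))]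
    · simp only [ha, hi, if_false]
      have := mul_nonneg (hw i) (sq_nonneg (z i))
      linarith
  rw [Matrix.add_mulVec, dotProduct_add, quad_diag, Matrix.smul_mulVec, dotProduct_smul,
    smul_eq_mul, h1]
  have h4 : |s * (a ⬝ᵥ Z *ᵥ a)| ≤ m * (a ⬝ᵥ a) := by
    rw [abs_mul]
    have haa := self_dot_nonneg a
    calc _ ≤ m / (2 * C + 1) * (C * (a ⬝ᵥ a + a ⬝ᵥ a)) := by gcongr
      _ = m * (a ⬝ᵥ a) * (2 * C / (2 * C + 1)) := by ring
      _ ≤ m * (a ⬝ᵥ a) * 1 := by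
        apply mul_le_mul_of_nonneg_left _ (by positivity)
        rw [div_le_one (by positivity)]; linarith
      _ = _ := by ring
  have := (abs_le.mp h4).1
  linarith

lemma functional_mip {n : ℕ} (ζ : Matrix (Fin n) (Fin n) ℝ →ₗ[ℝ] ℝ) :
    ∃ Z : Matrix (Fin n) (Fin n) ℝ, ∀ M, ζ M = mip Z M := by
  refine ⟨Matrix.of fun i j => ζ (Matrix.single i j 1), fun M => ?_⟩
  conv_lhs => rw [Matrix.matrix_eq_sum_single M]
  rw [mip_sum, map_sum]
  refine Finset.sum_congr rfl fun i _ => ?_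
  rw [map_sum]
  refine Finset.sum_congr rfl fun j _ => ?_
  have : Matrix.single i j (M i j) = M i j • Matrix.single i j (1:ℝ) := by simp
  rw [this, map_smul]
  simp [mul_comm]

/-- the matrix restricted to an index block -/
def maskM {n : ℕ} (α : Fin n → Prop) (M : Matrix (Fin n) (Fin n) ℝ) : Matrix (Fin n) (Fin n) ℝ :=
  Matrix.of fun i j => if α i ∧ α j then M i j else 0

lemma mip_mask {n : ℕ} (α : Fin n → Prop) (Z M : Matrix (Fin n) (Fin n) ℝ) (hM : M.IsSymm) :
    mip Z (maskM α M) = mip (maskM α ((1/2 : ℝ) • (Z + Zᵀ))) M := by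
  have h1 : mip Z (maskM α M) = mip Zᵀ (maskM α M) := by
    rw [mip_sum, mip_sum, Finset.sum_comm]
    refine Finset.sum_congr rfl fun i _ => Finset.sum_congr rfl fun j _ => ?_
    simp only [maskM, Matrix.of_apply, Matrix.transpose_apply, hM.apply i j, and_comm]
  have h2 : mip Z (maskM α M) = mip ((1/2 : ℝ) • (Z + Zᵀ)) (maskM α M) := by
    rw [mip_smul_left, mip_add_left, ← h1]; ring
  rw [h2, mip_sum, mip_sum]
  refine Finset.sum_congr rfl fun i _ => Finset.sum_congr rfl fun j _ => ?_
  simp only [maskM, Matrix.of_apply]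
  split_ifs <;> simp

lemma extreme_surj {n : ℕ} [NeZero n] {EX EY : Type*} [AddCommGroup EX] [Module ℝ EX]
    [AddCommGroup EY]
    [Module ℝ EY] (φ : EX →ₗ[ℝ] ℝ) (G : EX →ₗ[ℝ] Matrix (Fin n) (Fin n) ℝ) (A : EX →ₗ[ℝ] EY)
    {X Y U : Matrix (Fin n) (Fin n) ℝ} (hX : X.IsSymm) (hA : Function.Surjective A)
    (hG : ∀ d, (G d).IsSymm) (hY : Y ∈ (MulSet φ G A X).extremePoints ℝ)
    (hUX : U ∈ OSet X) (hUY : U ∈ OSet Y) (hv : ∀ i, lamVec Y i ≠ 0 → lamVec X i = lamVec X 0)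
    (p : EY) (q : Matrix (Fin n) (Fin n) ℝ) (hq : q.IsSymm) :
    ∃ (w₀ : EX) (c : ℝ), A w₀ = p ∧ ∀ i j, lamVec Y i ≠ 0 → lamVec Y j ≠ 0 →
      (Uᵀ * G w₀ * U) i j = q i j + if i = j then c else 0 := by
  obtain ⟨hUU, hXd⟩ := hUX
  obtain ⟨-, hYd⟩ := hUY
  set α : Fin n → Prop := fun i => lamVec Y i ≠ 0 with hα
  rw [mem_extremePoints] at hY
  obtain ⟨hYS, hext⟩ := hY
  obtain ⟨hYs, hYp, hYt, hYX⟩ := msub_forward hX hYS.1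
  have hw := psd_eigs hYp hUU hYd
  let T : EX × ℝ →ₗ[ℝ] EY × Matrix (Fin n) (Fin n) ℝ :=
    { toFun := fun x => (A x.1, maskM α (Uᵀ * G x.1 * U - x.2 • (1 : Matrix (Fin n) (Fin n) ℝ)))
      map_add' := by
        intro x y
        refine Prod.ext (by simp) ?_
        ext i j
        simp only [maskM, Matrix.of_apply, Prod.fst_add, Prod.snd_add, Matrix.add_apply,
          Matrix.sub_apply, map_add, mul_add, add_mul, add_smul]
        split_ifs
        · ring
        · ring
      map_smul' := by
        intro c y
        refine Prod.ext (by simp) ?_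
        ext i j
        simp only [maskM, Matrix.of_apply, Prod.smul_fst, Prod.smul_snd, Matrix.smul_apply,
          Matrix.sub_apply, map_smul, mul_smul_comm, smul_mul_assoc, smul_eq_mul, RingHom.id_apply]
        split_ifs
        · ring
        · ring }
  have hT : ∀ x c, T (x, c) =
    (A x, maskM α (Uᵀ * G x * U - c • (1 : Matrix (Fin n) (Fin n) ℝ))) := fun x c => rfl
  by_cases hin : (p, maskM α q) ∈ LinearMap.range T
  · obtain ⟨⟨x, c⟩, hx⟩ := hin
    rw [hT, Prod.mk.injEq] at hx
    refine ⟨x, c, hx.1, fun i j hi hj => ?_⟩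
    have := congrFun (congrFun hx.2 i) j
    simp only [maskM, Matrix.of_apply, hα] at this
    rw [if_pos ⟨hi, hj⟩, if_pos ⟨hi, hj⟩] at this
    rw [← this, Matrix.sub_apply, Matrix.smul_apply, Matrix.one_apply]
    split_ifs <;> simp
  exfalso
  obtain ⟨F, hF1, hF2⟩ := Submodule.exists_le_ker_of_notMem hin
  have hFT : ∀ x c, F (T (x, c)) = 0 := fun x c => hF2 ⟨(x, c), rfl⟩
  obtain ⟨Z, hZ⟩ := functional_mip (F ∘ₗ LinearMap.inr ℝ EY (Matrix (Fin n) (Fin n) ℝ))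
  set ℓ : EY →ₗ[ℝ] ℝ := F ∘ₗ LinearMap.inl ℝ EY (Matrix (Fin n) (Fin n) ℝ) with hℓ
  set Z' := maskM α ((1/2 : ℝ) • (Z + Zᵀ)) with hZ'
  have hFs : ∀ y M, M.IsSymm → F (y, maskM α M) = ℓ y + mip Z' M := by
    intro y M hM
    have : (y, maskM α M) = LinearMap.inl ℝ EY (Matrix (Fin n) (Fin n) ℝ) y +
        LinearMap.inr ℝ EY (Matrix (Fin n) (Fin n) ℝ) (maskM α M) := by simp
    rw [this, map_add, hZ', ← mip_mask α Z M hM, ← hZ]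
    rfl
  have hone : ∀ c : ℝ, (c • (1 : Matrix (Fin n) (Fin n) ℝ)).IsSymm := fun c =>
    (Matrix.isSymm_one).smul c
  have hG0 : ∀ x, ℓ (A x) + mip Z' (Uᵀ * G x * U) = 0 := by
    intro x
    have := hFT x 0
    rw [hT, hFs _ _ ((conj_symm (hG x) U).sub (hone 0))] at this
    simpa using this
  have htr : Z'.trace = 0 := by
    have := hFT 0 1
    rw [hT, hFs _ _ ((conj_symm (hG 0) U).sub (hone 1))] at this
    simp [mip] at this
    exact this
  have hZs : Z'.IsSymm := by
    ext i j
    simp only [hZ', maskM, Matrix.transpose_apply, Matrix.of_apply, Matrix.smul_apply,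
      Matrix.add_apply]
    by_cases h1 : α i <;> by_cases h2 : α j <;> simp [h1, h2, add_comm]
  have hZ0 : ∀ i j, ¬ (α i ∧ α j) → Z' i j = 0 := fun i j hij => by
    simp only [hZ', maskM, Matrix.of_apply, if_neg hij]
  obtain ⟨t, ht, hpsd⟩ := pert_psd α (lamVec Y)
    (fun i hi => lt_of_le_of_ne (hw i) (Ne.symm hi)) hw Z' hZ0
  set W := U * Z' * Uᵀ with hW
  have hWX : mip W X = 0 := by
    have h1 : Uᵀ * X * U = Matrix.diagonal (lamVec X) := by
      conv_lhs => rw [hXd]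
      rw [show Uᵀ * (U * Matrix.diagonal (lamVec X) * Uᵀ) * U =
        (Uᵀ * U) * Matrix.diagonal (lamVec X) * (Uᵀ * U) by simp only [mul_assoc], hUU]
      simp
    rw [hW, mip_conj, h1, mip_sum]
    have : ∀ i, ∑ j, Z' i j * Matrix.diagonal (lamVec X) i j = lamVec X 0 * Z' i i := by
      intro i
      rw [Finset.sum_eq_single i]
      · rw [Matrix.diagonal_apply_eq]
        by_cases hi : α i
        · rw [hv i hi]; ring
        · rw [hZ0 i i (fun h => hi h.1)]; simp
      · intro j _ hj
        rw [Matrix.diagonal_apply_ne _ (Ne.symm hj), mul_zero]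
      · simp
    simp only [this, ← Finset.mul_sum]
    have : ∑ i, Z' i i = 0 := htr
    rw [this, mul_zero]
  have hmem : ∀ s : ℝ, |s| ≤ t → Y + s • W ∈ MulSet φ G A X := by
    intro s hs
    have he : Y + s • W = U * (Matrix.diagonal (lamVec Y) + s • Z') * Uᵀ := by
      rw [mul_add, add_mul, ← hYd, hW]; simp
    refine ⟨msub_backward ?_ ?_ ?_ ?_, ?_⟩
    · exact hYs.add ((conj_symm' hZs U).smul s)
    · intro z
      rw [he, quad_conj]
      exact hpsd s hs _
    · rw [Matrix.trace_add, Matrix.trace_smul, hW, trace_conj hUU, htr, hYt]; simp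
    · rw [mip_add_left, mip_smul_left, hWX, hYX]; simp
    · intro d hd
      rw [mip_add_left, mip_smul_left, hW, mip_conj]
      have h1 := hG0 d
      rw [hd, map_zero, zero_add] at h1
      rw [h1]
      have := hYS.2 d hd
      linarith
  have hWe : Y + t • W = Y := by
    refine (hext _ (hmem t (abs_of_pos ht).le) _ (hmem (-t) (by rw [abs_neg, abs_of_pos ht])) ?_).1
    refine ⟨1/2, 1/2, by norm_num, by norm_num, by norm_num, ?_⟩
    ext i j
    simp
    ring
  have hW0 : W = 0 := by
    have : t • W = 0 := by simpa using hWe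
    exact (smul_eq_zero.mp this).resolve_left ht.ne'
  have hZz : Z' = 0 := by
    have : Uᵀ * W * U = Z' := by
      rw [hW, show Uᵀ * (U * Z' * Uᵀ) * U = (Uᵀ * U) * Z' * (Uᵀ * U) by simp only [mul_assoc], hUU]
      simp
    rw [← this, hW0]; simp
  apply hF1
  rw [hFs p q hq]
  obtain ⟨x, rfl⟩ := hA p
  have := hG0 x
  rw [hZz] at this ⊢
  simp [mip] at this ⊢
  exact this

lemma factor_surj {EX EY : Type*} [NormedAddCommGroup EX] [InnerProductSpace ℝ EX]
    [FiniteDimensional ℝ EX] [NormedAddCommGroup EY] [InnerProductSpace ℝ EY]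
    [FiniteDimensional ℝ EY] (φ : EX →L[ℝ] ℝ) (A : EX →L[ℝ] EY) (hA : Function.Surjective A)
    (h : ∀ d, A d = 0 → φ d = 0) : ∃ y : EY, ∀ d, φ d + ⟪y, A d⟫ = 0 := by
  obtain ⟨B, hB⟩ := (A : EX →ₗ[ℝ] EY).exists_rightInverse_of_surjective
    (LinearMap.range_eq_top.mpr hA)
  have hB' : ∀ p, A (B p) = p := fun p => LinearMap.congr_fun hB p
  let ψ : EY →L[ℝ] ℝ := LinearMap.toContinuousLinearMap ((φ : EX →ₗ[ℝ] ℝ) ∘ₗ B)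
  refine ⟨-(InnerProductSpace.toDual ℝ EY).symm ψ, fun d => ?_⟩
  rw [inner_neg_left, InnerProductSpace.toDual_symm_apply]
  have h1 : ψ (A d) = φ (B (A d)) := rfl
  have h2 := h (d - B (A d)) (by rw [map_sub, hB', sub_self])
  rw [map_sub] at h2
  rw [h1]; linarith

lemma gradient_zero_iff {EX : Type*} [NormedAddCommGroup EX] [InnerProductSpace ℝ EX]
    [FiniteDimensional ℝ EX] (F : EX → ℝ) (x : EX) :
    gradient F x = 0 ↔ ∀ d, fderiv ℝ F x d = 0 := by
  unfold gradient
  rw [LinearIsometryEquiv.map_eq_zero_iff]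
  constructor
  · intro h d; rw [h]; rfl
  · intro h; ext d; rw [h]; rfl

lemma fderiv_lagr {n : ℕ} {EX EY : Type*} [NormedAddCommGroup EX] [InnerProductSpace ℝ EX]
    [NormedAddCommGroup EY] [InnerProductSpace ℝ EY]
    {f : EX → ℝ} {g : EX → Matrix (Fin n) (Fin n) ℝ} {h : EX → EY} (x : EX)
    (hf : DifferentiableAt ℝ f x) (hg : DifferentiableAt ℝ g x) (hh : DifferentiableAt ℝ h x)
    (y : EY) (Y : Matrix (Fin n) (Fin n) ℝ) (d : EX) :
    fderiv ℝ (fun x => f x + mip Y (g x) + ⟪y, h x⟫) x d =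
      fderiv ℝ f x d + mip Y (fderiv ℝ g x d) + ⟪y, fderiv ℝ h x d⟫ := by
  have h1 : HasFDerivAt (fun x => mip Y (g x)) ((mipC Y).comp (fderiv ℝ g x)) x :=
    (mipC Y).hasFDerivAt.comp x hg.hasFDerivAt
  have h2 : HasFDerivAt (fun x => ⟪y, h x⟫) ((innerSL ℝ y).comp (fderiv ℝ h x)) x :=
    (innerSL ℝ y).hasFDerivAt.comp x hh.hasFDerivAt
  have h3 := (hf.hasFDerivAt.add h1).add h2
  have h4 : fderiv ℝ (fun x => f x + mip Y (g x) + ⟪y, h x⟫) x =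
    fderiv ℝ f x + (mipC Y).comp (fderiv ℝ g x) + (innerSL ℝ y).comp (fderiv ℝ h x) := h3.fderiv
  rw [h4]
  rfl

lemma diff_fderiv_apply {EX E : Type*} [NormedAddCommGroup EX] [NormedSpace ℝ EX]
    [NormedAddCommGroup E] [NormedSpace ℝ E] {F : EX → E} (hF : ContDiff ℝ 2 F) (d : EX) :
    Differentiable ℝ (fun x => fderiv ℝ F x d) := by
  have hF' : ContDiff ℝ 1 (fderiv ℝ F) := hF.fderiv_right (by norm_num)
  have hFd' : Differentiable ℝ (fderiv ℝ F) := hF'.differentiable (by norm_num)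
  exact hFd'.clm_apply (differentiable_const d)

lemma sec_lagr {n : ℕ} {EX EY : Type*} [NormedAddCommGroup EX] [InnerProductSpace ℝ EX]
    [NormedAddCommGroup EY] [InnerProductSpace ℝ EY]
    {f : EX → ℝ} {g : EX → Matrix (Fin n) (Fin n) ℝ} {h : EX → EY} (x : EX)
    (hf : ContDiff ℝ 2 f) (hg : ContDiff ℝ 2 g) (hh : ContDiff ℝ 2 h)
    (y : EY) (Y : Matrix (Fin n) (Fin n) ℝ) (d : EX) :
    fderiv ℝ (fun x' => fderiv ℝ (fun x => f x + mip Y (g x) + ⟪y, h x⟫) x' d) x d =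
      sec f x d + mip Y (sec g x d) + ⟪y, sec h x d⟫ := by
  have h1 : (fun x' => fderiv ℝ (fun x => f x + mip Y (g x) + ⟪y, h x⟫) x' d) =
      fun x' => fderiv ℝ f x' d + mip Y (fderiv ℝ g x' d) + ⟪y, fderiv ℝ h x' d⟫ := by
    funext x'
    exact fderiv_lagr x' (hf.differentiable (by norm_num) x') (hg.differentiable (by norm_num) x')
      (hh.differentiable (by norm_num) x') y Y d
  rw [h1]
  exact fderiv_lagr x (diff_fderiv_apply hf d x) (diff_fderiv_apply hg d x)
    (diff_fderiv_apply hh d x) y Y d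

lemma fderiv_symm {n : ℕ} {EX : Type*} [NormedAddCommGroup EX] [NormedSpace ℝ EX]
    {F : EX → Matrix (Fin n) (Fin n) ℝ} (hs : ∀ x, (F x).IsSymm) (hd : Differentiable ℝ F)
    (x d : EX) : (fderiv ℝ F x d).IsSymm := by
  let T : Matrix (Fin n) (Fin n) ℝ →L[ℝ] Matrix (Fin n) (Fin n) ℝ :=
    LinearMap.toContinuousLinearMap
      { toFun := fun A => Aᵀ
        map_add' := fun A B => Matrix.transpose_add A B
        map_smul' := fun c A => Matrix.transpose_smul c A }
  have h1 : HasFDerivAt (fun x => T (F x)) (T.comp (fderiv ℝ F x)) x :=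
    T.hasFDerivAt.comp x (hd x).hasFDerivAt
  have h2 : (fun x => T (F x)) = F := funext fun x => hs x
  rw [h2] at h1
  have h3 := h1.unique (hd x).hasFDerivAt
  exact congrArg (fun L => L d) h3

lemma rem_bound {n : ℕ} {U : Matrix (Fin n) (Fin n) ℝ} (hU : Uᵀ * U = 1)
    (R : Matrix (Fin n) (Fin n) ℝ) (z : Fin n → ℝ) :
    z ⬝ᵥ (Uᵀ * R * U) *ᵥ z ≤ 2 * (n : ℝ) ^ 2 * ‖R‖ * (z ⬝ᵥ z) := by
  have hU' : (Uᵀ)ᵀ * Uᵀ = 1 := by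
    rw [Matrix.transpose_transpose]; exact mul_eq_one_comm.mp hU
  have h1 := quad_conj Uᵀ R z
  have h2 := norm_conj hU' z
  rw [Matrix.transpose_transpose] at h1 h2
  rw [h1]
  have h3 := (le_abs_self _).trans (quad_bound R (U *ᵥ z) (U *ᵥ z))
  rw [h2] at h3
  have h4 : ∑ i, ∑ j, |R i j| ≤ (n : ℝ) ^ 2 * ‖R‖ := by
    calc _ ≤ ∑ i : Fin n, ∑ j : Fin n, ‖R‖ :=
          Finset.sum_le_sum fun i _ => Finset.sum_le_sum fun j _ => Matrix.norm_entry_le_entrywise_sup_norm R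
      _ = _ := by simp; ring
  have h5 := self_dot_nonneg z
  refine h3.trans ?_
  calc _ ≤ (n : ℝ) ^ 2 * ‖R‖ * (z ⬝ᵥ z + z ⬝ᵥ z) := by gcongr
    _ = _ := by ring

lemma lam_upper {n : ℕ} [NeZero n] {EX : Type*} [NormedAddCommGroup EX] [NormedSpace ℝ EX]
    {g : EX → Matrix (Fin n) (Fin n) ℝ} (hg : ContDiff ℝ 2 g) (hgs : ∀ x, (g x).IsSymm)
    (xb d w : EX) {U P : Matrix (Fin n) (Fin n) ℝ} (hU : Uᵀ * U = 1) (hP : P.IsSymm) (v : ℝ)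
    (D : Fin n → ℝ) (α : Fin n → Prop) (δ : ℝ) (hδ : 0 < δ)
    (hD0 : ∀ i, α i → D i = 0) (hD : ∀ i, ¬ α i → δ ≤ D i)
    (hUP : Uᵀ * (g xb - P) * U = Matrix.diagonal (fun i => v - D i))
    (H K : Matrix (Fin n) (Fin n) ℝ) (hHe : H = Uᵀ * fderiv ℝ g xb d * U)
    (hKe : K = Uᵀ * (sec g xb d + fderiv ℝ g xb w) * U)  (μ c : ℝ)
    (hH : ∀ i j, α i → α j → H i j = if i = j then μ else 0)
    (hK : ∀ i j, α i → α j →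
      (K + (2 : ℝ) • (H * Matrix.diagonal (fun l => (D l)⁻¹) * H)) i j = if i = j then c else 0)
    (ε : ℝ) (hε : 0 < ε) :
    ∃ η₀ > 0, ∀ η, 0 < η → η ≤ η₀ → ∀ᶠ t : ℝ in 𝓝[>] 0,
      ∀ x, ‖x - (xb + t • d + (t ^ 2 / 2) • w)‖ ≤ η * t ^ 2 →
        lamVec (g x - P) 0 ≤ v + t * μ + t ^ 2 / 2 * c + ε * t ^ 2 := by
  have hgd : Differentiable ℝ g := hg.differentiable (by norm_num)
  have hHs : H.IsSymm := by rw [hHe]; exact conj_symm (fderiv_symm hgs hgd _ _) U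
  have hKs : K.IsSymm := by
    rw [hKe]
    exact conj_symm ((fderiv_symm (fun x => fderiv_symm hgs hgd x d)
      (diff_fderiv_apply hg d) xb d).add (fderiv_symm hgs hgd _ _)) U
  have hn : 0 < 2 * (n : ℝ) ^ 2 := by
    have : 0 < (n : ℝ) := by exact_mod_cast Nat.pos_of_ne_zero (NeZero.ne n)
    positivity
  obtain ⟨η₀, hη₀, hT⟩ := taylor_near hg xb d w (ε / 2 / (2 * (n : ℝ) ^ 2)) (by positivity)
  refine ⟨η₀, hη₀, fun η hη hle => ?_⟩
  have hS := second_order_upper D α δ hδ hD0 hD H K hHs hKs μ c hH hK (ε / 2) (by positivity)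
  filter_upwards [(hT η hη hle).filter_mono nhdsWithin_le_nhds, hS] with t h1 h2 x hx
  specialize h1 x hx
  set R := g x - g xb - t • fderiv ℝ g xb d
        - (t ^ 2 / 2) • (sec g xb d + fderiv ℝ g xb w) with hR
  refine lam_le_of_conj ((hgs x).sub hP) hU fun z => ?_
  have he : Uᵀ * (g x - P) * U = Matrix.diagonal (fun i => v - D i) + t • H + (t ^ 2 / 2) • K
      + Uᵀ * R * U := by
    rw [← hUP, hHe, hKe, hR]
    simp only [mul_sub, mul_add, sub_mul, add_mul, mul_smul_comm, smul_mul_assoc, smul_add]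
    abel
  rw [he]
  simp only [Matrix.add_mulVec, dotProduct_add, Matrix.smul_mulVec, dotProduct_smul, smul_eq_mul]
  rw [quad_diag]
  have h3 := h2 z
  have h4 := rem_bound hU R z
  have hz := self_dot_nonneg z
  have h5 : 2 * (n : ℝ) ^ 2 * ‖R‖ * (z ⬝ᵥ z) ≤ ε / 2 * t ^ 2 * (z ⬝ᵥ z) := by
    apply mul_le_mul_of_nonneg_right _ hz
    calc _ ≤ 2 * (n : ℝ) ^ 2 * (ε / 2 / (2 * (n : ℝ) ^ 2) * t ^ 2) :=
          mul_le_mul_of_nonneg_left h1 hn.le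
      _ = _ := by
          have hn0 : (n : ℝ) ≠ 0 := by exact_mod_cast NeZero.ne n
          field_simp
  have h6 : ∑ i, (v - D i) * z i ^ 2 = v * (z ⬝ᵥ z) - ∑ i, D i * z i ^ 2 := by
    simp only [dotProduct, Finset.mul_sum, sub_mul, Finset.sum_sub_distrib, sq]
  rw [h6]
  nlinarith

lemma growth_pos {EX EY : Type*} [NormedAddCommGroup EX] [NormedSpace ℝ EX] [CompleteSpace EX]
    [NormedAddCommGroup EY] [NormedSpace ℝ EY] [CompleteSpace EY]
    {f : EX → ℝ} {h : EX → EY} (hf : ContDiff ℝ 2 f) (hh : ContDiff ℝ 2 h) (xb d w : EX)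
    (hd0 : d ≠ 0)
    (hsurj : Function.Surjective (fderiv ℝ h xb)) (h0 : h xb = 0) (hd : fderiv ℝ h xb d = 0)
    (hw : sec h xb d + fderiv ℝ h xb w = 0) (l : EX → ℝ) (v μ c ρ : ℝ) (hρ : 0 < ρ)
    (hμ : fderiv ℝ f xb d + μ = 0)
    (hl : ∀ ε : ℝ, 0 < ε → ∃ η₀ > 0, ∀ η, 0 < η → η ≤ η₀ → ∀ᶠ t : ℝ in 𝓝[>] 0,
      ∀ x, ‖x - (xb + t • d + (t ^ 2 / 2) • w)‖ ≤ η * t ^ 2 →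
        l x ≤ v + t * μ + t ^ 2 / 2 * c + ε * t ^ 2)
    {V : Set EX} (hV : V ∈ 𝓝 xb)
    (hg : ∀ x ∈ V, h x = 0 → f xb + v + ρ * ‖x - xb‖ ^ 2 ≤ f x + l x) :
    0 < sec f xb d + fderiv ℝ f xb w + c := by
  by_contra hκ
  push Not at hκ
  have hdn : 0 < ‖d‖ := norm_pos_iff.mpr hd0
  set ε := ρ * ‖d‖ ^ 2 / 16 with hε
  have hεp : 0 < ε := by positivity
  obtain ⟨η₁, hη₁, h1⟩ := taylor_near hf xb d w ε hεp
  obtain ⟨η₂, hη₂, h2⟩ := hl ε hεp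
  set η := min η₁ η₂ with hη
  have hηp : 0 < η := lt_min hη₁ hη₂
  have e1 := (h1 η hηp (min_le_left _ _)).filter_mono (nhdsWithin_le_nhds (s := Set.Ioi (0:ℝ)))
  have e2 := h2 η hηp (min_le_right _ _)
  have e3 := (feasible_near hh xb d w hsurj h0 hd hw η hηp).filter_mono
    (nhdsWithin_le_nhds (s := Set.Ioi (0:ℝ)))
  have e4 := (near_curve xb d w η hV).filter_mono (nhdsWithin_le_nhds (s := Set.Ioi (0:ℝ)))
  have e5 : ∀ᶠ t : ℝ in 𝓝[>] 0, t * (‖w‖ / 2 + η) < ‖d‖ / 2 := by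
    have : Tendsto (fun t : ℝ => t * (‖w‖ / 2 + η)) (𝓝 0) (𝓝 0) := by
      have : Continuous (fun t : ℝ => t * (‖w‖ / 2 + η)) := by fun_prop
      simpa using this.tendsto 0
    exact (this.eventually_lt_const (by positivity)).filter_mono nhdsWithin_le_nhds
  have e6 : ∀ᶠ t : ℝ in 𝓝[>] 0, 0 < t := eventually_mem_nhdsWithin
  obtain ⟨t, a1, a2, ⟨x, hx, hx0⟩, a4, a5, ht⟩ :=
    (e1.and (e2.and (e3.and (e4.and (e5.and e6))))).exists
  have b1 := a1 x hx
  have b2 := a2 x hx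
  have b3 := hg x (a4 x hx) hx0
  have b4 := (abs_le.mp ((Real.norm_eq_abs _).symm.le.trans b1)).2
  simp only [smul_eq_mul] at b4
  have b5 : t * ‖d‖ / 2 ≤ ‖x - xb‖ := by
    have : t • d = (x - xb) - (x - (xb + t • d + (t ^ 2 / 2) • w)) - (t ^ 2 / 2) • w := by abel
    have h3 : ‖t • d‖ ≤ ‖x - xb‖ + η * t ^ 2 + t ^ 2 / 2 * ‖w‖ := by
      rw [this]
      refine (norm_sub_le _ _).trans ?_
      rw [norm_smul (t ^ 2 / 2) w, Real.norm_of_nonneg (by positivity : 0 ≤ t ^ 2 / 2)]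
      linarith [norm_sub_le (x - xb) (x - (xb + t • d + (t ^ 2 / 2) • w))]
    rw [norm_smul, Real.norm_of_nonneg ht.le] at h3
    nlinarith [mul_lt_mul_of_pos_left a5 ht]
  have b6 : (t * ‖d‖ / 2) ^ 2 ≤ ‖x - xb‖ ^ 2 := pow_le_pow_left₀ (by positivity) b5 2
  have b7 := mul_le_mul_of_nonneg_left b6 hρ.le
  have b8 : t ^ 2 / 2 * (sec f xb d + fderiv ℝ f xb w + c) ≤ 0 :=
    mul_nonpos_of_nonneg_of_nonpos (by positivity) hκ
  have b9 : 0 < ρ * (t * ‖d‖ / 2) ^ 2 := by positivity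
  have b10 : ε * t ^ 2 = ρ * (t * ‖d‖ / 2) ^ 2 / 4 := by rw [hε]; ring
  have b11 : t * fderiv ℝ f xb d + t * μ = 0 := by rw [← mul_add, hμ, mul_zero]
  rw [b10] at b2 b4
  linarith

/-- Proposition 5.2.  For the problem
`min f(x) + λ₁(g(x))  s.t.  h(x) = 0`, if Robinson's constraint qualification
(surjectivity of `h'(x̄)`) holds at a stationary point `x̄` and the uniform quadratic growth
condition holds at `x̄` with respect to every `C²`-smooth parameterization, then the strong
second-order sufficient condition holds at `x̄`. -/
theorem stmt19 {n : ℕ} [NeZero n] {EX EY : Type*}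
    [NormedAddCommGroup EX] [InnerProductSpace ℝ EX] [FiniteDimensional ℝ EX]
    [NormedAddCommGroup EY] [InnerProductSpace ℝ EY] [FiniteDimensional ℝ EY]
    (lam1 : Matrix (Fin n) (Fin n) ℝ → ℝ)
    (hlam1 : lam1 = fun X => lamVec X 0)
    (f : EX → ℝ) (g : EX → Matrix (Fin n) (Fin n) ℝ) (h : EX → EY)
    (hf : ContDiff ℝ 2 f) (hg : ContDiff ℝ 2 g) (hh : ContDiff ℝ 2 h)
    (hgs : ∀ x, (g x).IsSymm)
    (L : EX → EY → Matrix (Fin n) (Fin n) ℝ → ℝ)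
    (hL : L = fun x y Y => f x + mip Y (g x) + ⟪y, h x⟫)
    (xb : EX)
    (Mul : Set (EY × Matrix (Fin n) (Fin n) ℝ))
    (hMul : Mul = {m | gradient (fun x => L x m.1 m.2) xb = 0 ∧ h xb = 0 ∧
      m.2 ∈ msubdiff lam1 (g xb)})
    (hstat : Mul.Nonempty)
    (hRCQ : Function.Surjective (fderiv ℝ h xb))
    -- uniform quadratic growth with respect to every C²-smooth parameterization
    (huqg : ∀ (EU : Type) [NormedAddCommGroup EU] [NormedSpace ℝ EU],
      ∀ (ub : EU) (fp : EX × EU → ℝ) (gp : EX × EU → Matrix (Fin n) (Fin n) ℝ)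
        (hp : EX × EU → EY),
        ContDiff ℝ 2 fp → ContDiff ℝ 2 gp → ContDiff ℝ 2 hp →
        (∀ x, fp (x, ub) = f x) → (∀ x, gp (x, ub) = g x) → (∀ x, hp (x, ub) = h x) →
        ∃ ρ : ℝ, 0 < ρ ∧ ∃ V ∈ 𝓝 xb, ∃ U ∈ 𝓝 ub,
          ∀ u ∈ U, ∀ xu ∈ V,
            (hp (xu, u) = 0 ∧ ∃ (y : EY) (Y : Matrix (Fin n) (Fin n) ℝ),
              Y ∈ msubdiff lam1 (gp (xu, u)) ∧
              gradient (fun x => fp (x, u) + mip Y (gp (x, u)) + ⟪y, hp (x, u)⟫) xu = 0) →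
            ∀ x ∈ V, hp (x, u) = 0 →
              fp (xu, u) + lam1 (gp (xu, u)) + ρ * ‖x - xu‖^2 ≤
                fp (x, u) + lam1 (gp (x, u))) :
    -- strong second-order sufficient condition
    ∀ dd : EX, dd ≠ 0 →
      (∀ m ∈ Mul, fderiv ℝ h xb dd = 0 ∧
        fderiv ℝ g xb dd ∈ affineSpan ℝ {H : Matrix (Fin n) (Fin n) ℝ |
          H.IsSymm ∧ dirDeriv lam1 (g xb) H = mip m.2 H}) →
      ∃ m ∈ Mul,
        (fderiv ℝ (fun x' => (fderiv ℝ (fun x'' => L x'' m.1 m.2) x') dd) xb) dd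
          - UpsilonC (g xb) m.2 (fderiv ℝ g xb dd) > 0 := by
  subst hlam1 hL hMul
  intro dd hdd0 happ
  obtain ⟨⟨y0, Y0⟩, hgr0, hxb0, hY0⟩ := hstat
  have hX : (g xb).IsSymm := hgs xb
  have hfd : Differentiable ℝ f := hf.differentiable (by norm_num)
  have hgd : Differentiable ℝ g := hg.differentiable (by norm_num)
  have hhd : Differentiable ℝ h := hh.differentiable (by norm_num)
  have hGs : ∀ d, (fderiv ℝ g xb d).IsSymm := fderiv_symm hgs hgd xb
  -- an extreme multiplier
  have hne : (MulSet (fderiv ℝ f xb : EX →ₗ[ℝ] ℝ)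
      (fderiv ℝ g xb : EX →ₗ[ℝ] Matrix (Fin n) (Fin n) ℝ)
      (fderiv ℝ h xb : EX →ₗ[ℝ] EY) (g xb)).Nonempty := by
    refine ⟨Y0, hY0, fun d hd => ?_⟩
    have h1 := (gradient_zero_iff _ _).mp hgr0 d
    have h2 := fderiv_lagr xb (hfd xb) (hgd xb) (hhd xb) y0 Y0 d
    have h3 : fderiv ℝ h xb d = 0 := hd
    rw [h3, inner_zero_right, add_zero] at h2
    exact h2.symm.trans h1
  obtain ⟨Y, hYe⟩ := MulSet_extreme _ _ _ (g xb) hX hne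
  have hYS := hYe.1
  obtain ⟨hYs, hYp, hYt, hYX⟩ := msub_forward hX hYS.1
  obtain ⟨y, hy⟩ := factor_surj (fderiv ℝ f xb + (mipC Y).comp (fderiv ℝ g xb)) (fderiv ℝ h xb)
    hRCQ (fun d hd => hYS.2 d hd)
  have hy' : ∀ d, fderiv ℝ f xb d + mip Y (fderiv ℝ g xb d) + ⟪y, fderiv ℝ h xb d⟫ = 0 := hy
  have hgrad : gradient (fun x => f x + mip Y (g x) + ⟪y, h x⟫) xb = 0 := by
    rw [gradient_zero_iff]
    intro d
    rw [fderiv_lagr xb (hfd xb) (hgd xb) (hhd xb) y Y d, hy']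
  refine ⟨(y, Y), ⟨hgrad, hxb0, hYS.1⟩, ?_⟩
  obtain ⟨hdh, hdg⟩ := happ (y, Y) ⟨hgrad, hxb0, hYS.1⟩
  dsimp only at hdg ⊢
  -- the common eigenbasis
  have hUspec : (Classical.epsilon fun U => U ∈ OSet (g xb) ∩ OSet Y) ∈ OSet (g xb) ∩ OSet Y :=
    Classical.epsilon_spec (exists_joint hX hYs hYp hYt hYX)
  unfold UpsilonC
  set U := Classical.epsilon fun U => U ∈ OSet (g xb) ∩ OSet Y with hUdef
  obtain ⟨hUX, hUY⟩ := hUspec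
  have hUU := hUX.1
  have hXd := hUX.2
  have hYd := hUY.2
  set v := lamVec (g xb) 0 with hvdef
  have hconj : ∀ M : Matrix (Fin n) (Fin n) ℝ, Uᵀ * (U * M * Uᵀ) * U = M := by
    intro M
    rw [show Uᵀ * (U * M * Uᵀ) * U = (Uᵀ * U) * M * (Uᵀ * U) by simp only [mul_assoc], hUU]
    simp
  have hXc : Uᵀ * g xb * U = Matrix.diagonal (lamVec (g xb)) := by
    conv_lhs => rw [hXd]
    exact hconj _
  have hw0 := psd_eigs hYp hUU hYd
  have hw1 : ∑ i, lamVec Y i = 1 := by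
    rw [← hYt]
    conv_rhs => rw [hYd]
    rw [trace_conj hUU, Matrix.trace_diagonal]
  have hlam : ∀ i, lamVec (g xb) i ≤ v := fun i => lamVec_antitone _ (Fin.zero_le i)
  have hv : ∀ i, lamVec Y i ≠ 0 → lamVec (g xb) i = v := by
    have h1 : ∑ i, lamVec Y i * (v - lamVec (g xb) i) = 0 := by
      have h2 := mip_diag (A := g xb) hYs hYd
      rw [hYX, hXc] at h2
      simp only [Matrix.diagonal_apply_eq] at h2
      simp only [mul_sub, Finset.sum_sub_distrib, ← Finset.sum_mul, hw1, ← h2]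
      ring
    have h2 := (Finset.sum_eq_zero_iff_of_nonneg (fun i _ =>
      mul_nonneg (hw0 i) (sub_nonneg.mpr (hlam i)))).mp h1
    intro i hi
    have := (mul_eq_zero.mp (h2 i (Finset.mem_univ i))).resolve_left hi
    linarith
  -- the perturbation
  set b : Fin n → ℝ := fun i => if lamVec (g xb) i = v ∧ lamVec Y i = 0 then 1 else 0 with hb
  have hb0 : ∀ i, 0 ≤ b i := fun i => by simp only [hb]; split_ifs <;> norm_num
  set B := U * Matrix.diagonal b * Uᵀ with hB
  have hBs : B.IsSymm := conj_symm' (Matrix.isSymm_diagonal b) U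
  have hYB : mip Y B = 0 := by
    rw [mip_diag hYs hYd, hB, hconj]
    refine Finset.sum_eq_zero fun i _ => ?_
    rw [Matrix.diagonal_apply_eq]
    by_cases hi : lamVec Y i = 0
    · rw [hi, zero_mul]
    · simp [hb, hi]
  have hXB : ∀ u : ℝ, Uᵀ * (g xb - u • B) * U =
      Matrix.diagonal (fun i => v - (v - lamVec (g xb) i + u * b i)) := by
    intro u
    rw [mul_sub, sub_mul, hXc, mul_smul_comm, smul_mul_assoc, hB, hconj]
    ext i j
    by_cases hij : i = j
    · subst hij; simp; ring
    · simp [Matrix.diagonal_apply_ne _ hij]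
  have hYu : ∀ u : ℝ, mip Y (g xb - u • B) = v := by
    intro u
    rw [mip_sub, mip_smul, hYB, hYX]; ring
  have hlu : ∀ u : ℝ, 0 ≤ u → lamVec (g xb - u • B) 0 = v := by
    intro u hu
    have hs : (g xb - u • B).IsSymm := hX.sub (hBs.smul u)
    refine le_antisymm (lam_le_of_conj hs hUU fun z => ?_) ?_
    · rw [hXB, quad_diag]
      simp only [dotProduct, Finset.mul_sum]
      refine Finset.sum_le_sum fun i _ => ?_
      have h1 : 0 ≤ v - lamVec (g xb) i + u * b i :=
        add_nonneg (sub_nonneg.mpr (hlam i)) (mul_nonneg hu (hb0 i))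
      nlinarith [mul_nonneg h1 (sq_nonneg (z i))]
    · rw [← hYu u]
      exact lam_ge_mip hs hYs hYp hYt
  obtain ⟨ρ, hρ, V, hV, W, hW, hgrow⟩ := huqg ℝ 0 (fun p => f p.1) (fun p => g p.1 - p.2 • B)
    (fun p => h p.1) (hf.comp contDiff_fst)
    ((hg.comp contDiff_fst).sub (contDiff_snd.smul contDiff_const)) (hh.comp contDiff_fst)
    (fun x => rfl) (fun x => by simp) (fun x => rfl)
  obtain ⟨r, hr, hrW⟩ := Metric.mem_nhds_iff.mp hW
  set u : ℝ := r / 2 with hu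
  have hupos : 0 < u := by positivity
  have huW : u ∈ W := hrW (by
    rw [Metric.mem_ball, Real.dist_eq, sub_zero, abs_of_pos hupos, hu]; linarith)
  have hgrow' := hgrow u huW xb (mem_of_mem_nhds hV) ⟨hxb0, y, Y,
    msub_backward hYs hYp hYt (by rw [hYu, hlu u hupos.le]), by
      have : (fun x => f x + mip Y (g x - u • B) + ⟪y, h x⟫) =
          fun x => f x + mip Y (g x) + ⟪y, h x⟫ := by
        funext x
        rw [mip_sub, mip_smul, hYB]; ring
      simp only [this]
      exact hgrad⟩
  dsimp only at hgrow'
  rw [hlu u hupos.le] at hgrow'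
  -- data of the second order expansion
  set D : Fin n → ℝ := fun i => v - lamVec (g xb) i + u * b i with hD
  have hD0 : ∀ i, lamVec Y i ≠ 0 → D i = 0 := fun i hi => by simp [hD, hb, hi, hv i hi]
  obtain ⟨δ, hδ, hDδ⟩ := exists_pos_lb (fun i => ¬ lamVec Y i ≠ 0) D (by
    intro i hi
    have hi' : lamVec Y i = 0 := not_not.mp hi
    by_cases hl : lamVec (g xb) i = v
    · simp [hD, hb, hl, hi', hupos]
    · have : lamVec (g xb) i < v := lt_of_le_of_ne (hlam i) hl
      simp [hD, hb, hl, this])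
  set H := Uᵀ * fderiv ℝ g xb dd * U with hH
  have hHs : H.IsSymm := conj_symm (hGs dd) U
  have hcb := crit_block hX hYs hYp hYt hUX hUY hv hdg
  have hsecs : (sec g xb dd).IsSymm :=
    fderiv_symm (fun x => fderiv_symm hgs hgd x dd) (diff_fderiv_apply hg dd) xb dd
  set Q := H * Matrix.diagonal (fun l => (D l)⁻¹) * H with hQ
  have hQs : Q.IsSymm := by
    have := conj_symm (Matrix.isSymm_diagonal (fun l => (D l)⁻¹)) H
    rwa [hHs.eq] at this
  obtain ⟨w, c, hwp, hwq⟩ := extreme_surj (fderiv ℝ f xb : EX →ₗ[ℝ] ℝ)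
      (fderiv ℝ g xb : EX →ₗ[ℝ] Matrix (Fin n) (Fin n) ℝ)
      (fderiv ℝ h xb : EX →ₗ[ℝ] EY) hX hRCQ hGs hYe hUX hUY hv (-(sec h xb dd))
      (-(Uᵀ * sec g xb dd * U) - (2 : ℝ) • Q) ((conj_symm hsecs U).neg.sub (hQs.smul 2))
  have hwp' : fderiv ℝ h xb w = -(sec h xb dd) := hwp
  set K := Uᵀ * (sec g xb dd + fderiv ℝ g xb w) * U with hK
  have hKc : ∀ i j, lamVec Y i ≠ 0 → lamVec Y j ≠ 0 →
      (K + (2 : ℝ) • Q) i j = if i = j then c else 0 := by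
    intro i j hi hj
    have h1 : (Uᵀ * fderiv ℝ g xb w * U) i j =
      (-(Uᵀ * sec g xb dd * U) - (2 : ℝ) • Q) i j + if i = j then c else 0 := hwq i j hi hj
    rw [hK, mul_add, add_mul, Matrix.add_apply, Matrix.add_apply, h1, Matrix.sub_apply,
      Matrix.neg_apply]
    ring
  have hμ : fderiv ℝ f xb dd + mip Y (fderiv ℝ g xb dd) = 0 := hYS.2 dd hdh
  have hpos := growth_pos hf hh xb dd w hdd0 hRCQ hxb0 hdh (by rw [hwp']; simp)
    (fun x => lamVec (g x - u • B) 0) v (mip Y (fderiv ℝ g xb dd)) c ρ hρ hμ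
    (fun ε hε => lam_upper hg hgs xb dd w hUU (hBs.smul u) v D (fun i => lamVec Y i ≠ 0) δ hδ
      hD0 hDδ (hXB u) H K hH hK _ c (fun i j hi hj => hcb i j hi (hv j hj)) hKc ε hε) hV hgrow'
  -- the value of `c`
  have hcval : c = mip Y (sec g xb dd + fderiv ℝ g xb w)
      - Upsilon (g xb) Y U (fderiv ℝ g xb dd) := by
    rw [upsilon_eq (hGs dd) hUX hv, mip_diag hYs hYd, sub_neg_eq_add, Finset.mul_sum,
      ← Finset.sum_add_distrib]
    have h1 : c = ∑ i, lamVec Y i * c := by rw [← Finset.sum_mul, hw1, one_mul]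
    rw [h1]
    refine Finset.sum_congr rfl fun i _ => ?_
    by_cases hi : lamVec Y i = 0
    · simp [hi]
    · have h2 := hKc i i hi hi
      rw [if_pos rfl] at h2
      have h3 : Q i i = ∑ l, H i l ^ 2 * (v - lamVec (g xb) l)⁻¹ := by
        rw [hQ, Matrix.mul_apply]
        refine Finset.sum_congr rfl fun l _ => ?_
        rw [Matrix.mul_diagonal, hHs.apply i l]
        by_cases hl : lamVec (g xb) l = v
        · by_cases hil : i = l
          · subst hil
            rw [hD0 i hi, hl]; simp
          · have : H i l = 0 := (hcb i l hi hl).trans (if_neg hil)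
            rw [this]; simp
        · have : D l = v - lamVec (g xb) l := by simp [hD, hb, hl]
          rw [this]; ring
      rw [← h2, Matrix.add_apply, Matrix.smul_apply, h3, smul_eq_mul]
      ring
  have hsec := sec_lagr xb hf hg hh y Y dd
  rw [hsec]
  have h5 := hy' w
  rw [hwp', inner_neg_right] at h5
  rw [hcval, mip_add] at hpos
  linarith

end
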